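/- Fix an integer ℓ > 2 and a residue i with 0 ≤ i < ℓ. For every node λ of the ladder crystal B(Λ0)^L, regularization commutes with the crystal operators: R(\hat f_i λ) = \tilde f_i (Rλ) and R(\hat e_i λ) = \tilde e_i (Rλ) (with the convention that R applied to 0 is 0). -/

import Mathlib

noncomputable section

/-!
Common combinatorial definitions: partitions (English notation, rows indexed from 1),
Young diagrams, hooks, rim hooks, ladders, residues, crystal operators (classical and
ladder versions), locked boxes, regularization classes, dominance order.
-/

structure YPartition where
  part : ℕ → ℕ
  zero_at_zero : part 0 = 0
  antitone : ∀ i j : ℕ, 1 ≤ i → i ≤ j → part j ≤ part i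
  eventually_zero : ∃ N : ℕ, ∀ i : ℕ, N ≤ i → part i = 0

namespace YPartition

/-- The set of boxes of the Young diagram of `μ` (row, column), both indices ≥ 1. -/
def cells (μ : YPartition) : Set (ℕ × ℕ) :=
  {p | 1 ≤ p.1 ∧ 1 ≤ p.2 ∧ p.2 ≤ μ.part p.1}

/-- The length of column `b`: the number of rows containing a box in column `b`. -/
def colLen (μ : YPartition) (b : ℕ) : ℕ :=
  Nat.card {a : ℕ | 1 ≤ a ∧ b ≤ μ.part a}

/-- The arm of box `(a,b)`: boxes strictly to its right in its row. -/
def arm (μ : YPartition) (a b : ℕ) : ℕ := μ.part a - b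

/-- The leg of box `(a,b)`: boxes strictly below it in its column. -/
def leg (μ : YPartition) (a b : ℕ) : ℕ := μ.colLen b - a

/-- The hook length of the box `(a,b)`: arm + leg + 1. -/
def hook (μ : YPartition) (a b : ℕ) : ℕ := (μ.part a - b) + (μ.colLen b - a) + 1

/-- The number of boxes of `μ`. -/
def size (μ : YPartition) : ℕ := μ.cells.ncard

/-- The number of (nonzero) parts of `μ`. -/
def length (μ : YPartition) : ℕ := μ.colLen 1

/-- `μ` is an `(ℓ,0)`-JM partition: there are no boxes `(a,b)`, `(a,y)`, `(x,b)` with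
`ℓ ∣ hook (a,b)` while `ℓ` divides neither `hook (a,y)` nor `hook (x,b)`. -/
def IsJM (ℓ : ℕ) (μ : YPartition) : Prop :=
  ¬ ∃ a b y x : ℕ, (a, b) ∈ μ.cells ∧ (a, y) ∈ μ.cells ∧ (x, b) ∈ μ.cells ∧
    ℓ ∣ μ.hook a b ∧ ¬ ℓ ∣ μ.hook a y ∧ ¬ ℓ ∣ μ.hook x b

/-- Two boxes share an edge. -/
def BoxAdjacent (p q : ℕ × ℕ) : Prop :=
  (p.1 = q.1 ∧ (p.2 + 1 = q.2 ∨ q.2 + 1 = p.2)) ∨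
  (p.2 = q.2 ∧ (p.1 + 1 = q.1 ∨ q.1 + 1 = p.1))

/-- A set of boxes is connected (via shared edges, inside the set). -/
def SetConnected (S : Set (ℕ × ℕ)) : Prop :=
  ∀ p ∈ S, ∀ q ∈ S,
    Relation.ReflTransGen (fun x y => x ∈ S ∧ y ∈ S ∧ BoxAdjacent x y) p q

/-- `S` contains no 2 × 2 square of boxes. -/
def HasNoSquare (S : Set (ℕ × ℕ)) : Prop :=
  ¬ ∃ a b : ℕ, (a, b) ∈ S ∧ (a + 1, b) ∈ S ∧ (a, b + 1) ∈ S ∧ (a + 1, b + 1) ∈ S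

/-- `S` is a removable `ℓ`-rim hook of `μ`: a connected set of `ℓ` boxes of `μ` with no
2 × 2 square whose removal leaves the Young diagram of a partition. -/
def IsRimHook (ℓ : ℕ) (μ : YPartition) (S : Set (ℕ × ℕ)) : Prop :=
  S ⊆ μ.cells ∧ S.ncard = ℓ ∧ SetConnected S ∧ HasNoSquare S ∧
    ∃ ν : YPartition, ν.cells = μ.cells \ S

/-- `S` is contained in a single row. -/
def HorizontalHook (S : Set (ℕ × ℕ)) : Prop := ∃ a : ℕ, ∀ p ∈ S, p.1 = a

/-- `S` is contained in a single column. -/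
def VerticalHook (S : Set (ℕ × ℕ)) : Prop := ∃ b : ℕ, ∀ p ∈ S, p.2 = b

/-- Two sets of boxes are adjacent when some box of one shares an edge with a box of the other. -/
def SetsAdjacent (R S : Set (ℕ × ℕ)) : Prop := ∃ p ∈ R, ∃ q ∈ S, BoxAdjacent p q

/-- An `ℓ`-core: a partition with no removable `ℓ`-rim hook. -/
def IsCore (ℓ : ℕ) (μ : YPartition) : Prop := ¬ ∃ S : Set (ℕ × ℕ), IsRimHook ℓ μ S

/-- `p` and `q` lie on the same ladder: going down one column step the row increases
by `ℓ - 1`. -/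
def SameLadder (ℓ : ℕ) (p q : ℕ × ℕ) : Prop :=
  (q.1 : ℤ) - (p.1 : ℤ) = ((ℓ : ℤ) - 1) * ((p.2 : ℤ) - (q.2 : ℤ))

/-- The index of the ladder through `p`: the ladder through `(k,1)` has index `k`. -/
def ladderIdx (ℓ : ℕ) (p : ℕ × ℕ) : ℕ := p.1 + (ℓ - 1) * (p.2 - 1)

/-- The residue of position `(a,b)` is `b - a` mod `ℓ`. -/
def res (ℓ : ℕ) (p : ℕ × ℕ) : ℕ := (((p.2 : ℤ) - (p.1 : ℤ)) % (ℓ : ℤ)).toNat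

/-- `p` is a removable box of `μ`. -/
def Removable (μ : YPartition) (p : ℕ × ℕ) : Prop :=
  1 ≤ p.1 ∧ p.2 = μ.part p.1 ∧ μ.part (p.1 + 1) < p.2

/-- `p` is an addable box of `μ`. -/
def Addable (μ : YPartition) (p : ℕ × ℕ) : Prop :=
  1 ≤ p.1 ∧ p.2 = μ.part p.1 + 1 ∧ (p.1 = 1 ∨ p.2 ≤ μ.part (p.1 - 1))

/-- The removable `i`-boxes of `μ`. -/
def RemovableRes (ℓ i : ℕ) (μ : YPartition) : Set (ℕ × ℕ) :=
  {p | Removable μ p ∧ res ℓ p = i}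

/-- The addable `i`-boxes of `μ`. -/
def AddableRes (ℓ i : ℕ) (μ : YPartition) : Set (ℕ × ℕ) :=
  {p | Addable μ p ∧ res ℓ p = i}

/-- Ladder reading order (reflexive): ladders left to right, top to bottom within a ladder.
`LadderLE ℓ p q` means `p` is read before (or equal to) `q`. -/
def LadderLE (ℓ : ℕ) (p q : ℕ × ℕ) : Prop :=
  ladderIdx ℓ p < ladderIdx ℓ q ∨ (ladderIdx ℓ p = ladderIdx ℓ q ∧ p.1 ≤ q.1)

/-- Strict ladder reading order. -/
def LadderLT (ℓ : ℕ) (p q : ℕ × ℕ) : Prop :=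
  ladderIdx ℓ p < ladderIdx ℓ q ∨ (ladderIdx ℓ p = ladderIdx ℓ q ∧ p.1 < q.1)

/-- Classical reading order (reflexive): rows from bottom to top.
`RowLE p q` means `p` is read before (or equal to) `q`. -/
def RowLE (p q : ℕ × ℕ) : Prop := q.1 ≤ p.1

/-- Given a reading order `le`, a set `Rem` of `-` marks and `Add` of `+` marks, a `-` at `p`
survives the cancellation of adjacent `-+` pairs iff every interval of the reading word
starting at `p` contains strictly more `-`'s than `+`'s. -/
def NormalIn (le : ℕ × ℕ → ℕ × ℕ → Prop) (Rem Add : Set (ℕ × ℕ)) (p : ℕ × ℕ) : Prop :=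
  p ∈ Rem ∧ ∀ q ∈ Rem ∪ Add, le p q →
    (Add ∩ {s | le p s ∧ le s q}).ncard < (Rem ∩ {s | le p s ∧ le s q}).ncard

/-- A `+` at `q` survives the cancellation of adjacent `-+` pairs iff every interval of the
reading word ending at `q` contains strictly more `+`'s than `-`'s. -/
def ConormalIn (le : ℕ × ℕ → ℕ × ℕ → Prop) (Rem Add : Set (ℕ × ℕ)) (q : ℕ × ℕ) : Prop :=
  q ∈ Add ∧ ∀ p ∈ Rem ∪ Add, le p q →
    (Rem ∩ {s | le p s ∧ le s q}).ncard < (Add ∩ {s | le p s ∧ le s q}).ncard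

/-- Ladder normal `i`-box. -/
def LadderNormal (ℓ i : ℕ) (μ : YPartition) (p : ℕ × ℕ) : Prop :=
  NormalIn (LadderLE ℓ) (RemovableRes ℓ i μ) (AddableRes ℓ i μ) p

/-- Ladder conormal `i`-box. -/
def LadderConormal (ℓ i : ℕ) (μ : YPartition) (p : ℕ × ℕ) : Prop :=
  ConormalIn (LadderLE ℓ) (RemovableRes ℓ i μ) (AddableRes ℓ i μ) p

/-- Normal `i`-box (classical signature). -/
def ClassNormal (ℓ i : ℕ) (μ : YPartition) (p : ℕ × ℕ) : Prop :=
  NormalIn RowLE (RemovableRes ℓ i μ) (AddableRes ℓ i μ) p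

/-- Conormal `i`-box (classical signature). -/
def ClassConormal (ℓ i : ℕ) (μ : YPartition) (p : ℕ × ℕ) : Prop :=
  ConormalIn RowLE (RemovableRes ℓ i μ) (AddableRes ℓ i μ) p

/-- `ε̂_i(μ)`: number of ladder normal `i`-boxes. -/
def hatEps (ℓ i : ℕ) (μ : YPartition) : ℕ := {p | LadderNormal ℓ i μ p}.ncard

/-- `φ̂_i(μ)`: number of ladder conormal `i`-boxes. -/
def hatPhi (ℓ i : ℕ) (μ : YPartition) : ℕ := {p | LadderConormal ℓ i μ p}.ncard

/-- `ε_i(μ)`: number of normal `i`-boxes. -/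
def eps (ℓ i : ℕ) (μ : YPartition) : ℕ := {p | ClassNormal ℓ i μ p}.ncard

/-- `φ_i(μ)`: number of conormal `i`-boxes. -/
def phi (ℓ i : ℕ) (μ : YPartition) : ℕ := {p | ClassConormal ℓ i μ p}.ncard

/-- The ladder good `i`-box: the leftmost `-` of the reduced ladder `i`-signature. -/
def LadderGood (ℓ i : ℕ) (μ : YPartition) (p : ℕ × ℕ) : Prop :=
  LadderNormal ℓ i μ p ∧ ∀ q, LadderNormal ℓ i μ q → LadderLE ℓ p q

/-- The ladder cogood `i`-box: the rightmost `+` of the reduced ladder `i`-signature. -/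
def LadderCogood (ℓ i : ℕ) (μ : YPartition) (p : ℕ × ℕ) : Prop :=
  LadderConormal ℓ i μ p ∧ ∀ q, LadderConormal ℓ i μ q → LadderLE ℓ q p

/-- The good `i`-box (classical). -/
def ClassGood (ℓ i : ℕ) (μ : YPartition) (p : ℕ × ℕ) : Prop :=
  ClassNormal ℓ i μ p ∧ ∀ q, ClassNormal ℓ i μ q → RowLE p q

/-- The cogood `i`-box (classical). -/
def ClassCogood (ℓ i : ℕ) (μ : YPartition) (p : ℕ × ℕ) : Prop :=
  ClassConormal ℓ i μ p ∧ ∀ q, ClassConormal ℓ i μ q → RowLE q p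

/-- The ladder crystal operator `f̂_i` as a relation: `mu = f̂_i lam ≠ 0`. -/
def HatF (ℓ i : ℕ) (lam mu : YPartition) : Prop :=
  ∃ p, LadderCogood ℓ i lam p ∧ mu.cells = insert p lam.cells

/-- The ladder crystal operator `ê_i` as a relation: `mu = ê_i lam ≠ 0`. -/
def HatE (ℓ i : ℕ) (lam mu : YPartition) : Prop :=
  ∃ p, LadderGood ℓ i lam p ∧ mu.cells = lam.cells \ {p}

/-- The classical crystal operator `f̃_i` as a relation: `mu = f̃_i lam ≠ 0`. -/
def TildeF (ℓ i : ℕ) (lam mu : YPartition) : Prop :=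
  ∃ p, ClassCogood ℓ i lam p ∧ mu.cells = insert p lam.cells

/-- The classical crystal operator `ẽ_i` as a relation: `mu = ẽ_i lam ≠ 0`. -/
def TildeE (ℓ i : ℕ) (lam mu : YPartition) : Prop :=
  ∃ p, ClassGood ℓ i lam p ∧ mu.cells = lam.cells \ {p}

/-- `n`-fold composition of a relation. -/
def RelIter {α : Type} (r : α → α → Prop) : ℕ → α → α → Prop
  | 0 => fun a b => a = b
  | n + 1 => fun a b => ∃ c, r a c ∧ RelIter r n c b

/-- The empty partition. -/
def emptyP : YPartition where
  part := fun _ => 0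
  zero_at_zero := rfl
  antitone := fun _ _ _ _ => le_rfl
  eventually_zero := ⟨0, fun _ _ => rfl⟩

/-- `μ` is a node of the ladder crystal `B(Λ₀)^L`: it is obtained from the empty
partition by finitely many applications of the operators `f̂_i`, `0 ≤ i < ℓ`. -/
def LadderNode (ℓ : ℕ) (μ : YPartition) : Prop :=
  Relation.ReflTransGen (fun a b => ∃ i : ℕ, i < ℓ ∧ HatF ℓ i a b) emptyP μ

/-- The type I locking condition at `(a,b)`: every unoccupied position on the ladder of
`(a,b)` lying below it has an unoccupied position directly above it. -/
def LadderClear (ℓ : ℕ) (μ : YPartition) (a b : ℕ) : Prop :=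
  ∀ c d : ℕ, 1 ≤ c → 1 ≤ d → SameLadder ℓ (a, b) (c, d) → a < c →
    (c, d) ∉ μ.cells → (c - 1, d) ∉ μ.cells

/-- Locked boxes of `μ`. -/
inductive Locked (ℓ : ℕ) (μ : YPartition) : ℕ × ℕ → Prop where
  | typeI_top : ∀ b : ℕ, (1, b) ∈ μ.cells → LadderClear ℓ μ 1 b → Locked ℓ μ (1, b)
  | typeI_up : ∀ a b : ℕ, (a + 1, b) ∈ μ.cells → Locked ℓ μ (a, b) →
      LadderClear ℓ μ (a + 1) b → Locked ℓ μ (a + 1, b)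
  | typeII : ∀ a b b' : ℕ, (a, b) ∈ μ.cells → b < b' → Locked ℓ μ (a, b') → Locked ℓ μ (a, b)

/-- Number of boxes of `μ` on the `k`-th ladder. -/
def ladderCount (ℓ : ℕ) (μ : YPartition) (k : ℕ) : ℕ :=
  (μ.cells ∩ {p | ladderIdx ℓ p = k}).ncard

/-- `lam` and `mu` lie in the same regularization class: they have the same number of
boxes on every ladder. -/
def SameRegClass (ℓ : ℕ) (lam mu : YPartition) : Prop :=
  ∀ k : ℕ, ladderCount ℓ lam k = ladderCount ℓ mu k

/-- The boxes of `μ` are top-justified on each ladder. -/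
def TopJustified (ℓ : ℕ) (μ : YPartition) : Prop :=
  ∀ p ∈ μ.cells, ∀ q : ℕ × ℕ, 1 ≤ q.1 → 1 ≤ q.2 →
    ladderIdx ℓ q = ladderIdx ℓ p → q.1 < p.1 → q ∈ μ.cells

/-- `mu = R lam`: the regularization of `lam`, obtained by moving every box of `lam` to
the topmost unoccupied positions of its ladder. -/
def IsRegularization (ℓ : ℕ) (lam mu : YPartition) : Prop :=
  SameRegClass ℓ lam mu ∧ TopJustified ℓ mu

/-- Dominance order on partitions. -/
def DomLE (lam mu : YPartition) : Prop :=
  ∀ j : ℕ, ∑ i ∈ Finset.Icc 1 j, lam.part i ≤ ∑ i ∈ Finset.Icc 1 j, mu.part i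

/-- All (positive) positions on the `k`-th ladder. -/
def LadderPositions (ℓ k : ℕ) : Set (ℕ × ℕ) :=
  {p | 1 ≤ p.1 ∧ 1 ≤ p.2 ∧ ladderIdx ℓ p = k}

/-- The set of locked boxes of `μ`. -/
def lockedCells (ℓ : ℕ) (μ : YPartition) : Set (ℕ × ℕ) := {p | Locked ℓ μ p}

/-- The number of unlocked boxes of `μ` on the `k`-th ladder. -/
def unlockedCount (ℓ : ℕ) (μ : YPartition) (k : ℕ) : ℕ :=
  ((μ.cells ∩ LadderPositions ℓ k) \ lockedCells ℓ μ).ncard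

/-- The diagram `S μ`: locked boxes stay put, and on each ladder the unlocked boxes are
moved into the lowest positions of that ladder not occupied by locked boxes. -/
def SCells (ℓ : ℕ) (μ : YPartition) : Set (ℕ × ℕ) :=
  lockedCells ℓ μ ∪
    {p | 1 ≤ p.1 ∧ 1 ≤ p.2 ∧ p ∉ lockedCells ℓ μ ∧
      ((LadderPositions ℓ (ladderIdx ℓ p) ∩ {q | p.1 < q.1}) \ lockedCells ℓ μ).ncard
        < unlockedCount ℓ μ (ladderIdx ℓ p)}

/-- `μ` is `ℓ`-regular: no part occurs `ℓ` or more times. -/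
def IsRegular (ℓ : ℕ) (μ : YPartition) : Prop :=
  ∀ a : ℕ, 1 ≤ a → 0 < μ.part (a + (ℓ - 1)) → μ.part (a + (ℓ - 1)) < μ.part a

/-- Removal of a single horizontal or vertical `ℓ`-rim hook. -/
def RemoveHV (ℓ : ℕ) (lam mu : YPartition) : Prop :=
  ∃ S : Set (ℕ × ℕ), IsRimHook ℓ lam S ∧ (HorizontalHook S ∨ VerticalHook S) ∧
    mu.cells = lam.cells \ S

/-- Condition (1): every removable `ℓ`-rim hook is horizontal or vertical. -/
def Cond1 (ℓ : ℕ) (μ : YPartition) : Prop :=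
  ∀ S : Set (ℕ × ℕ), IsRimHook ℓ μ S → HorizontalHook S ∨ VerticalHook S

/-- Condition (2): no vertical (resp. horizontal) `ℓ`-rim hook `R` of `μ` together with an
adjacent horizontal (resp. vertical) `ℓ`-rim hook `S` of `μ \ R` . -/
def Cond2 (ℓ : ℕ) (μ : YPartition) : Prop :=
  ¬ ∃ (R S : Set (ℕ × ℕ)) (ν : YPartition), IsRimHook ℓ μ R ∧ ν.cells = μ.cells \ R ∧
    IsRimHook ℓ ν S ∧ SetsAdjacent R S ∧
    ((VerticalHook R ∧ HorizontalHook S) ∨ (HorizontalHook R ∧ VerticalHook S))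

/-- A generalized `ℓ`-partition: conditions (1) and (2) hold after removing any sequence of
horizontal and vertical `ℓ`-rim hooks (including the empty sequence). -/
def IsGenLPartition (ℓ : ℕ) (lam : YPartition) : Prop :=
  ∀ mu : YPartition, Relation.ReflTransGen (RemoveHV ℓ) lam mu → Cond1 ℓ mu ∧ Cond2 ℓ mu

/-- The `t`-th row (from the top) of the bottom block of the decomposition
`(μ, r, s, ρ, σ)`: the number of values `v ∈ [1, s+1]` whose column block still reaches
row `t`; column block `v` consists of `σ_v·ℓ + (s+1−v)(ℓ−1)` rows of length `≥ v`. -/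
def bottomPart (ℓ s : ℕ) (σ : YPartition) (t : ℕ) : ℕ :=
  ((Finset.Icc 1 (s + 1)).filter fun v => t ≤ σ.part v * ℓ + (s + 1 - v) * (ℓ - 1)).card

/-- The `i`-th part of the partition corresponding to the data `(μ, r, s, ρ, σ)`. -/
def decompPart (ℓ : ℕ) (mu : YPartition) (r s : ℕ) (ρ σ : YPartition) (i : ℕ) : ℕ :=
  if i = 0 then 0
  else if i ≤ r + 1 then s + mu.part 1 + (r + 1 - i) * (ℓ - 1) + ρ.part i * ℓ
  else if i ≤ r + max mu.length 1 then s + mu.part (i - r)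
  else bottomPart ℓ s σ (i - (r + max mu.length 1))

/-- Admissibility of the decomposition data `(μ, r, s, ρ, σ)`. -/
def GoodData (ℓ : ℕ) (mu : YPartition) (r s : ℕ) (ρ σ : YPartition) : Prop :=
  IsCore ℓ mu ∧ mu.part 1 < mu.part 2 + (ℓ - 1) ∧ mu.colLen 1 < mu.colLen 2 + (ℓ - 1) ∧
  ρ.length ≤ r + 1 ∧ σ.length ≤ s + 1 ∧
  (mu.cells = ∅ → ρ.part (r + 1) = 0 ∨ σ.part (s + 1) = 0)

/-- `lam ≈ (μ, r, s, ρ, σ)`. -/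
def Decomposes (ℓ : ℕ) (lam mu : YPartition) (r s : ℕ) (ρ σ : YPartition) : Prop :=
  ∀ i : ℕ, lam.part i = decompPart ℓ mu r s ρ σ i

/-- Removal of a single `ℓ`-rim hook. -/
def RemoveHook (ℓ : ℕ) (lam mu : YPartition) : Prop :=
  ∃ S : Set (ℕ × ℕ), IsRimHook ℓ lam S ∧ mu.cells = lam.cells \ S

/-- `lam` has `ℓ`-core `nu` and `ℓ`-weight `w`. -/
def HasCoreAndWeight (ℓ : ℕ) (lam nu : YPartition) (w : ℕ) : Prop :=
  IsCore ℓ nu ∧ RelIter (RemoveHook ℓ) w lam nu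

/-- An L-partition. -/
def IsLPartition (ℓ : ℕ) (lam : YPartition) : Prop :=
  ¬ ∃ p : ℕ × ℕ, p ∈ lam.cells ∧ ℓ ∣ lam.hook p.1 p.2 ∧
    (lam.arm p.1 p.2 < (ℓ - 1) * lam.leg p.1 p.2 ∨
     lam.leg p.1 p.2 < (ℓ - 1) * lam.arm p.1 p.2)

end YPartition

open YPartition
section Abstract

theorem conormal_char {κ β : Type} [LinearOrder κ] [LinearOrder β]
    (le : ℕ × ℕ → ℕ × ℕ → Prop) (key : ℕ × ℕ → κ) (hle : ∀ p q, le p q ↔ key p ≤ key q)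
    (Rem Add : Set (ℕ × ℕ)) (hR : Rem.Finite) (hA : Add.Finite) (BR BA : ℕ × ℕ → β)
    (hAA : ∀ x ∈ Add, ∀ y ∈ Add, BA x < BA y → key x < key y)
    (hRR : ∀ x ∈ Rem, ∀ y ∈ Rem, BR x < BR y → key x < key y)
    (hRA : ∀ x ∈ Rem, ∀ y ∈ Add, BR x ≤ BA y → key x < key y)
    (hAR : ∀ x ∈ Add, ∀ y ∈ Rem, BA x < BR y → key x < key y) (k : β) :
    (∃ q, ConormalIn le Rem Add q ∧ BA q = k) ↔
      ∀ j ≤ k, (Rem ∩ {s | j ≤ BR s ∧ BR s ≤ k}).ncard <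
        (Add ∩ {s | j ≤ BA s ∧ BA s ≤ k}).ncard := by
  constructor
  · rintro ⟨q, ⟨hq, hc⟩, rfl⟩ j hj
    obtain ⟨p, hpM, hpmin⟩ := Set.exists_min_image
      ((Rem ∩ {s | j ≤ BR s}) ∪ (Add ∩ {s | j ≤ BA s})) key
      ((hR.inter_of_left _).union (hA.inter_of_left _)) ⟨q, Or.inr ⟨hq, hj⟩⟩
    have hpq : key p ≤ key q := hpmin q (Or.inr ⟨hq, hj⟩)
    have h := hc p (hpM.imp (fun h => h.1) (fun h => h.1)) ((hle _ _).2 hpq)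
    refine lt_of_le_of_lt (Set.ncard_le_ncard ?_ (hR.inter_of_left _))
      (lt_of_lt_of_le h (Set.ncard_le_ncard ?_ (hA.inter_of_left _)))
    · rintro s ⟨hs, hs1, hs2⟩
      exact ⟨hs, (hle _ _).2 (hpmin s (Or.inl ⟨hs, hs1⟩)), (hle _ _).2 (hRA s hs q hq hs2).le⟩
    · rintro s ⟨hs, hs1, hs2⟩
      rw [hle] at hs1 hs2
      refine ⟨hs, ?_, ?_⟩
      · by_contra hlt
        rw [not_le] at hlt
        rcases hpM with ⟨hp, hp'⟩ | ⟨hp, hp'⟩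
        · exact absurd hs1 (not_le.2 (hAR s hs p hp (lt_of_lt_of_le hlt hp')))
        · exact absurd hs1 (not_le.2 (hAA s hs p hp (lt_of_lt_of_le hlt hp')))
      · by_contra hlt
        rw [not_le] at hlt
        exact absurd hs2 (not_le.2 (hAA q hq s hs hlt))
  · intro h
    have hne : (Add ∩ {s | BA s = k}).Nonempty := by
      have h1 := h k le_rfl
      have h2 : (Add ∩ {s | k ≤ BA s ∧ BA s ≤ k}).Nonempty := by
        rw [← Set.ncard_pos (hA.inter_of_left _)]; omega
      obtain ⟨s, hs, hs1, hs2⟩ := h2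
      exact ⟨s, hs, le_antisymm hs2 hs1⟩
    obtain ⟨q, ⟨hq, hqk⟩, hmax⟩ := Set.exists_max_image _ key (hA.inter_of_left _) hne
    have hqk : BA q = k := hqk
    refine ⟨q, ⟨hq, ?_⟩, hqk⟩
    have hAq : ∀ s ∈ Add, BA s ≤ k → key s ≤ key q := by
      intro s hs hsk
      rcases hsk.lt_or_eq with h1 | h1
      · exact (hAA s hs q hq (by rw [hqk]; exact h1)).le
      · exact hmax s ⟨hs, h1⟩
    have hRq : ∀ s ∈ Rem, key s ≤ key q → BR s ≤ k := by
      intro s hs hsk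
      by_contra hlt
      rw [not_le, ← hqk] at hlt
      exact absurd hsk (not_le.2 (hAR q hq s hs hlt))
    rintro p hp hpq
    rw [hle] at hpq
    rcases hp with hp | hp
    · refine lt_of_le_of_lt (Set.ncard_le_ncard ?_ (hR.inter_of_left _))
        (lt_of_lt_of_le (h (BR p) (hRq p hp hpq)) (Set.ncard_le_ncard ?_ (hA.inter_of_left _)))
      · rintro s ⟨hs, hs1, hs2⟩
        rw [hle] at hs1 hs2
        refine ⟨hs, ?_, hRq s hs hs2⟩
        by_contra hlt
        rw [not_le] at hlt
        exact absurd hs1 (not_le.2 (hRR s hs p hp hlt))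
      · rintro s ⟨hs, hs1, hs2⟩
        exact ⟨hs, (hle _ _).2 (hRA p hp s hs hs1).le, (hle _ _).2 (hAq s hs hs2)⟩
    · have hlater : ∀ s ∈ Rem, key p ≤ key s → BA p < BR s := by
        intro s hs hps
        by_contra hlt
        rw [not_lt] at hlt
        exact absurd hps (not_le.2 (hRA s hs p hp hlt))
      by_cases hex : (Rem ∩ {s | le p s ∧ le s q}).Nonempty
      · -- use the first removable in the interval
        obtain ⟨r, ⟨hr, hr1, hr2⟩, hmin⟩ :=
          Set.exists_min_image _ BR (hR.inter_of_left _) hex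
        rw [hle] at hr1 hr2
        refine lt_of_le_of_lt (Set.ncard_le_ncard ?_ (hR.inter_of_left _))
          (lt_of_lt_of_le (h (BR r) (hRq r hr hr2)) (Set.ncard_le_ncard ?_ (hA.inter_of_left _)))
        · rintro s ⟨hs, hs1, hs2⟩
          exact ⟨hs, hmin s ⟨hs, hs1, hs2⟩, hRq s hs ((hle _ _).1 hs2)⟩
        · rintro s ⟨hs, hs1, hs2⟩
          exact ⟨hs, (hle _ _).2 (hr1.trans (hRA r hr s hs hs1).le), (hle _ _).2 (hAq s hs hs2)⟩
      · rw [Set.not_nonempty_iff_eq_empty] at hex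
        rw [hex, Set.ncard_empty, Set.ncard_pos (hA.inter_of_left _)]
        exact ⟨q, hq, (hle _ _).2 hpq, (hle _ _).2 le_rfl⟩

theorem normal_iff_conormal (le : ℕ × ℕ → ℕ × ℕ → Prop) (Rem Add : Set (ℕ × ℕ)) (p : ℕ × ℕ) :
    NormalIn le Rem Add p ↔ ConormalIn (fun x y => le y x) Add Rem p := by
  unfold NormalIn ConormalIn
  have : ∀ q, {s | le p s ∧ le s q} = {s | le s q ∧ le p s} := by
    intro q; ext s; simp [and_comm]
  simp only [this, Set.union_comm Rem Add]

theorem normal_char {κ β : Type} [LinearOrder κ] [LinearOrder β]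
    (le : ℕ × ℕ → ℕ × ℕ → Prop) (key : ℕ × ℕ → κ) (hle : ∀ p q, le p q ↔ key p ≤ key q)
    (Rem Add : Set (ℕ × ℕ)) (hR : Rem.Finite) (hA : Add.Finite) (BR BA : ℕ × ℕ → β)
    (hAA : ∀ x ∈ Add, ∀ y ∈ Add, BA x < BA y → key x < key y)
    (hRR : ∀ x ∈ Rem, ∀ y ∈ Rem, BR x < BR y → key x < key y)
    (hRA : ∀ x ∈ Rem, ∀ y ∈ Add, BR x ≤ BA y → key x < key y)
    (hAR : ∀ x ∈ Add, ∀ y ∈ Rem, BA x < BR y → key x < key y) (k : β) :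
    (∃ q, NormalIn le Rem Add q ∧ BR q = k) ↔
      ∀ j, k ≤ j → (Add ∩ {s | k ≤ BA s ∧ BA s ≤ j}).ncard <
        (Rem ∩ {s | k ≤ BR s ∧ BR s ≤ j}).ncard := by
  have h := conormal_char (κ := κᵒᵈ) (β := βᵒᵈ) (fun x y => le y x)
    (fun x => OrderDual.toDual (key x)) (fun p q => hle q p) Add Rem hA hR
    (fun x => OrderDual.toDual (BA x)) (fun x => OrderDual.toDual (BR x))
    (fun x hx y hy hh => hRR y hy x hx hh) (fun x hx y hy hh => hAA y hy x hx hh)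
    (fun x hx y hy hh => hRA y hy x hx hh) (fun x hx y hy hh => hAR y hy x hx hh)
    (OrderDual.toDual k)
  simp only [normal_iff_conormal]
  refine (Iff.trans (by rfl) h).trans ?_
  have e : ∀ (S : Set (ℕ × ℕ)) (B : ℕ × ℕ → β) (j : β),
      S ∩ {s | OrderDual.toDual j ≤ OrderDual.toDual (B s) ∧
        OrderDual.toDual (B s) ≤ OrderDual.toDual k} = S ∩ {s | k ≤ B s ∧ B s ≤ j} := by
    intro S B j; ext s; simp [and_comm]
  constructor
  · intro h j hj
    have := h (OrderDual.toDual j) hj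
    rwa [e, e] at this
  · intro h j hj
    have := h (OrderDual.ofDual j) hj
    rw [← e, ← e] at this
    exact this

/-- extension of conormality to a later `+` with no `-` in between. -/
theorem conormal_ext {κ : Type} [LinearOrder κ]
    (le : ℕ × ℕ → ℕ × ℕ → Prop) (key : ℕ × ℕ → κ) (hle : ∀ p q, le p q ↔ key p ≤ key q)
    (Rem Add : Set (ℕ × ℕ)) (hR : Rem.Finite) (hA : Add.Finite) (n q : ℕ × ℕ)
    (hn : ConormalIn le Rem Add n) (hq : q ∈ Add) (hnq : key n ≤ key q)
    (hno : ∀ r ∈ Rem, key n ≤ key r → key r ≤ key q → False) : ConormalIn le Rem Add q := by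
  refine ⟨hq, fun p hp hpq => ?_⟩
  rw [hle] at hpq
  rcases le_or_gt (key p) (key n) with h | h
  · refine lt_of_le_of_lt (Set.ncard_le_ncard ?_ (hR.inter_of_left _))
      (lt_of_lt_of_le (hn.2 p hp ((hle _ _).2 h)) (Set.ncard_le_ncard ?_ (hA.inter_of_left _)))
    · rintro s ⟨hs, hs1, hs2⟩
      refine ⟨hs, hs1, ?_⟩
      rw [hle] at hs2 ⊢
      rcases le_total (key s) (key n) with h' | h'
      · exact h'
      · exact (hno s hs h' hs2).elim
    · rintro s ⟨hs, hs1, hs2⟩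
      refine ⟨hs, hs1, ?_⟩
      rw [hle] at hs2 ⊢
      exact hs2.trans hnq
  · have : Rem ∩ {s | le p s ∧ le s q} = ∅ := by
      ext s
      simp only [Set.mem_inter_iff, Set.mem_setOf_eq, Set.mem_empty_iff_false, iff_false, hle]
      rintro ⟨hs, h1, h2⟩
      exact hno s hs (h.le.trans h1) h2
    rw [this, Set.ncard_empty, Set.ncard_pos (hA.inter_of_left _)]
    exact ⟨q, hq, (hle _ _).2 hpq, (hle _ _).2 le_rfl⟩

theorem normal_ext {κ : Type} [LinearOrder κ]
    (le : ℕ × ℕ → ℕ × ℕ → Prop) (key : ℕ × ℕ → κ) (hle : ∀ p q, le p q ↔ key p ≤ key q)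
    (Rem Add : Set (ℕ × ℕ)) (hR : Rem.Finite) (hA : Add.Finite) (n q : ℕ × ℕ)
    (hn : NormalIn le Rem Add n) (hq : q ∈ Rem) (hnq : key q ≤ key n)
    (hno : ∀ r ∈ Add, key q ≤ key r → key r ≤ key n → False) : NormalIn le Rem Add q := by
  rw [normal_iff_conormal] at hn ⊢
  exact conormal_ext (κ := κᵒᵈ) (fun x y => le y x)
    (fun x => OrderDual.toDual (key x)) (fun p q => hle q p) Add Rem hA hR n q hn hq hnq
    (fun r hr h1 h2 => hno r hr h2 h1)

end Abstract

section Basics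

theorem mem_cells' (μ : YPartition) (a b : ℕ) :
    (a, b) ∈ μ.cells ↔ 1 ≤ a ∧ 1 ≤ b ∧ b ≤ μ.part a := Iff.rfl

theorem L_right (ℓ a b : ℕ) (hb : 1 ≤ b) :
    ladderIdx ℓ (a, b + 1) = ladderIdx ℓ (a, b) + (ℓ - 1) := by
  obtain ⟨b, rfl⟩ : ∃ c, b = c + 1 := ⟨b - 1, by omega⟩
  simp only [ladderIdx, Nat.add_sub_cancel]
  ring

theorem L_down (ℓ a b : ℕ) : ladderIdx ℓ (a + 1, b) = ladderIdx ℓ (a, b) + 1 := by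
  simp only [ladderIdx]; ring

theorem L_cast (ℓ a b : ℕ) (hℓ : 2 < ℓ) (hb : 1 ≤ b) :
    (ladderIdx ℓ (a, b) : ℤ) = a + ((ℓ : ℤ) - 1) * ((b : ℤ) - 1) := by
  simp only [ladderIdx]
  push_cast [Nat.cast_sub hb, Nat.cast_sub (show 1 ≤ ℓ by omega)]
  ring

theorem res_eq (ℓ : ℕ) (hℓ : 2 < ℓ) (p : ℕ × ℕ) (hp : 1 ≤ p.2) :
    res ℓ p = ((1 - (ladderIdx ℓ p : ℤ)) % (ℓ : ℤ)).toNat := by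
  obtain ⟨a, b⟩ := p
  rw [L_cast ℓ a b hℓ hp, res]
  have : ((b : ℤ) - a) = (1 - ((a : ℤ) + (ℓ - 1) * (b - 1))) + ℓ * (b - 1) := by ring
  simp only
  rw [this, Int.add_mul_emod_self_left]

theorem res_dvd (ℓ : ℕ) (hℓ : 2 < ℓ) (p q : ℕ × ℕ) (hp : 1 ≤ p.2) (hq : 1 ≤ q.2)
    (h : res ℓ p = res ℓ q) : (ℓ : ℤ) ∣ (ladderIdx ℓ q : ℤ) - ladderIdx ℓ p := by
  rw [res_eq ℓ hℓ p hp, res_eq ℓ hℓ q hq] at h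
  have h1 := Int.emod_nonneg (1 - (ladderIdx ℓ p : ℤ)) (show (ℓ : ℤ) ≠ 0 by omega)
  have h2 := Int.emod_nonneg (1 - (ladderIdx ℓ q : ℤ)) (show (ℓ : ℤ) ≠ 0 by omega)
  have h3 : (1 - (ladderIdx ℓ p : ℤ)) % (ℓ : ℤ) = (1 - (ladderIdx ℓ q : ℤ)) % (ℓ : ℤ) := by
    rw [← Int.toNat_of_nonneg h1, ← Int.toNat_of_nonneg h2, h]
  have h4 : (ℓ : ℤ) ∣ (1 - (ladderIdx ℓ p : ℤ)) - (1 - (ladderIdx ℓ q : ℤ)) :=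
    Int.ModEq.dvd (Int.ModEq.symm h3)
  have e : (1 - (ladderIdx ℓ p : ℤ)) - (1 - (ladderIdx ℓ q : ℤ)) =
    (ladderIdx ℓ q : ℤ) - ladderIdx ℓ p := by ring
  rwa [e] at h4

theorem res_gap (ℓ : ℕ) (hℓ : 2 < ℓ) (p q : ℕ × ℕ) (hp : 1 ≤ p.2) (hq : 1 ≤ q.2)
    (h : res ℓ p = res ℓ q) (hlt : ladderIdx ℓ p < ladderIdx ℓ q) :
    ladderIdx ℓ p + ℓ ≤ ladderIdx ℓ q := by
  have := Int.le_of_dvd (by omega) (res_dvd ℓ hℓ p q hp hq h)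
  omega

theorem res_congr (ℓ : ℕ) (hℓ : 2 < ℓ) (p q : ℕ × ℕ) (hp : 1 ≤ p.2) (hq : 1 ≤ q.2)
    (h : ladderIdx ℓ p = ladderIdx ℓ q) : res ℓ p = res ℓ q := by
  rw [res_eq ℓ hℓ p hp, res_eq ℓ hℓ q hq, h]

theorem res_congr_add (ℓ : ℕ) (hℓ : 2 < ℓ) (p q : ℕ × ℕ) (hp : 1 ≤ p.2) (hq : 1 ≤ q.2)
    (h : ladderIdx ℓ p + ℓ = ladderIdx ℓ q) : res ℓ p = res ℓ q := by
  rw [res_eq ℓ hℓ p hp, res_eq ℓ hℓ q hq, ← h]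
  push_cast
  have : (1 - ((ladderIdx ℓ p : ℤ) + ℓ)) = (1 - (ladderIdx ℓ p : ℤ)) + ℓ * (-1) := by ring
  rw [this, Int.add_mul_emod_self_left]

theorem L_row_inj (ℓ : ℕ) (hℓ : 2 < ℓ) (a b d : ℕ) (hb : 1 ≤ b) (hd : 1 ≤ d)
    (h : ladderIdx ℓ (a, b) = ladderIdx ℓ (a, d)) : b = d := by
  simp only [ladderIdx] at h
  have := Nat.eq_of_mul_eq_mul_left (show 0 < ℓ - 1 by omega) (Nat.add_left_cancel h)
  omega

theorem L_row_lt (ℓ : ℕ) (hℓ : 2 < ℓ) (a b c d : ℕ) (hb : 1 ≤ b) (hd : 1 ≤ d)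
    (h : ladderIdx ℓ (a, b) = ladderIdx ℓ (c, d)) (hac : a < c) : d < b := by
  by_contra hlt
  simp only [ladderIdx] at h
  have := Nat.mul_le_mul_left (ℓ - 1) (show b - 1 ≤ d - 1 by omega)
  omega

theorem addable_pos {μ : YPartition} {p : ℕ × ℕ} (h : Addable μ p) : 1 ≤ p.1 ∧ 1 ≤ p.2 :=
  ⟨h.1, by have := h.2.1; omega⟩

theorem addable_not_mem {μ : YPartition} {p : ℕ × ℕ} (h : Addable μ p) : p ∉ μ.cells := by
  rintro ⟨_, _, h3⟩
  have := h.2.1; omega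

theorem removable_mem {μ : YPartition} {p : ℕ × ℕ} (h : Removable μ p) : p ∈ μ.cells :=
  ⟨h.1, by have := h.2.2; omega, h.2.1.le⟩

theorem removable_right {μ : YPartition} {p : ℕ × ℕ} (h : Removable μ p) :
    (p.1, p.2 + 1) ∉ μ.cells := by
  rintro ⟨_, _, h3⟩
  have := h.2.1
  simp only at h3; omega

theorem removable_down {μ : YPartition} {p : ℕ × ℕ} (h : Removable μ p) :
    (p.1 + 1, p.2) ∉ μ.cells := by
  rintro ⟨_, _, h3⟩
  have := h.2.2
  simp only at h3; omega

theorem part_le {μ : YPartition} {a c : ℕ} (ha : 1 ≤ a) (h : a ≤ c) : μ.part c ≤ μ.part a :=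
  μ.antitone a c ha h

theorem cells_down {μ : YPartition} {a b c d : ℕ} (h : (c, d) ∈ μ.cells) (ha : 1 ≤ a) (hb : 1 ≤ b)
    (hac : a ≤ c) (hbd : b ≤ d) : (a, b) ∈ μ.cells :=
  ⟨ha, hb, hbd.trans (h.2.2.trans (part_le ha hac))⟩

theorem box_finite (μ : YPartition) : ∃ N : ℕ, ∀ a b, 1 ≤ a → 1 ≤ b →
    b ≤ μ.part a → a ≤ N ∧ b ≤ N := by
  obtain ⟨N, hN⟩ := μ.eventually_zero
  refine ⟨N + μ.part 1, fun a b ha hb h => ?_⟩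
  have h1 := part_le (μ := μ) le_rfl ha
  by_cases hc : N ≤ a
  · have := hN a hc; omega
  · omega

theorem cells_finite (μ : YPartition) : μ.cells.Finite := by
  obtain ⟨N, hN⟩ := box_finite μ
  refine (Set.finite_Iic ((N, N) : ℕ × ℕ)).subset ?_
  rintro ⟨a, b⟩ ⟨h1, h2, h3⟩
  exact hN a b h1 h2 h3

theorem addable_finite (μ : YPartition) : {p | Addable μ p}.Finite := by
  obtain ⟨N, hN⟩ := box_finite μ
  refine (Set.finite_Iic ((N + 1, N + 1) : ℕ × ℕ)).subset ?_
  rintro ⟨a, b⟩ ⟨h1, h2, h3⟩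
  simp only at h1 h2 h3
  rw [Set.mem_Iic, Prod.mk_le_mk]
  constructor
  · rcases h3 with h3 | h3
    · omega
    · by_cases ha : a = 1
      · omega
      · have := (hN (a - 1) b (by omega) (by omega) h3).1; omega
  · by_cases hb : b = 1
    · omega
    · have := (hN a (b - 1) h1 (by omega) (by omega)).2; omega

theorem addRes_finite (ℓ i : ℕ) (μ : YPartition) : (AddableRes ℓ i μ).Finite :=
  (addable_finite μ).subset fun _ h => h.1

theorem remRes_finite (ℓ i : ℕ) (μ : YPartition) : (RemovableRes ℓ i μ).Finite :=
  (cells_finite μ).subset fun _ h => removable_mem h.1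

theorem exists_add (μ : YPartition) (p : ℕ × ℕ) (h : Addable μ p) :
    ∃ ν : YPartition, ν.cells = insert p μ.cells := by
  obtain ⟨a, b⟩ := p
  obtain ⟨h1, h2, h3⟩ := h
  simp only at h1 h2 h3
  refine ⟨⟨fun x => if x = a then b else μ.part x, ?_, ?_, ?_⟩, ?_⟩
  · rw [if_neg (by omega)]; exact μ.zero_at_zero
  · intro x y hx hxy
    have e1 := part_le (μ := μ) hx hxy
    split_ifs with hy hx' hx'
    · omega
    · subst hy
      rcases h3 with h3 | h3
      · omega
      · have := part_le (μ := μ) hx (show x ≤ y - 1 by omega); omega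
    · subst hx'; omega
    · exact e1
  · obtain ⟨N, hN⟩ := μ.eventually_zero
    refine ⟨N + a + 1, fun x hx => ?_⟩
    rw [if_neg (by omega)]; exact hN x (by omega)
  · ext ⟨x, y⟩
    simp only [Set.mem_insert_iff, mem_cells', Prod.mk.injEq]
    split_ifs with hx
    · subst hx; omega
    · omega

theorem exists_rem (μ : YPartition) (p : ℕ × ℕ) (h : Removable μ p) :
    ∃ ν : YPartition, ν.cells = μ.cells \ {p} := by
  obtain ⟨a, b⟩ := p
  obtain ⟨h1, h2, h3⟩ := h
  simp only at h1 h2 h3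
  refine ⟨⟨fun x => if x = a then b - 1 else μ.part x, ?_, ?_, ?_⟩, ?_⟩
  · rw [if_neg (by omega)]; exact μ.zero_at_zero
  · intro x y hx hxy
    have e1 := part_le (μ := μ) hx hxy
    split_ifs with hy hx' hx'
    · omega
    · subst hy; omega
    · subst hx'
      have := part_le (μ := μ) (show 1 ≤ x + 1 by omega) (show x + 1 ≤ y by omega); omega
    · exact e1
  · obtain ⟨N, hN⟩ := μ.eventually_zero
    refine ⟨N + a + 1, fun x hx => ?_⟩
    rw [if_neg (by omega)]; exact hN x (by omega)
  · ext ⟨x, y⟩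
    simp only [Set.mem_sdiff, Set.mem_singleton_iff, mem_cells', Prod.mk.injEq]
    split_ifs with hx
    · subst hx; omega
    · omega

theorem addable_of_insert (μ ν : YPartition) (p : ℕ × ℕ) (h : ν.cells = insert p μ.cells)
    (hp : p ∉ μ.cells) : Addable μ p := by
  obtain ⟨a, b⟩ := p
  have hpν : (a, b) ∈ ν.cells := by rw [h]; exact Set.mem_insert _ _
  obtain ⟨h1, h2, h3⟩ := (mem_cells' _ _ _).1 hpν
  have key : ∀ x y, (x, y) ∈ ν.cells → (x, y) ≠ (a, b) → (x, y) ∈ μ.cells := by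
    intro x y hxy hne
    rw [h] at hxy
    exact hxy.resolve_left hne
  have hp' : μ.part a < b := by
    by_contra hlt; exact hp ⟨h1, h2, not_lt.1 hlt⟩
  refine ⟨h1, ?_, ?_⟩
  · simp only
    by_cases hb : b = 1
    · omega
    · have := (key a (b - 1) (cells_down hpν h1 (by omega) le_rfl (by omega))
        (by simp; omega)).2.2
      simp only at this; omega
  · simp only
    by_cases ha : a = 1
    · exact Or.inl ha
    · exact Or.inr (key (a - 1) b (cells_down hpν (by omega) h2 (by omega) le_rfl)
        (by simp; omega)).2.2

theorem removable_of_insert (μ ν : YPartition) (p : ℕ × ℕ) (h : μ.cells = insert p ν.cells)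
    (hp : p ∉ ν.cells) : Removable μ p := by
  obtain ⟨a, b⟩ := p
  have hpμ : (a, b) ∈ μ.cells := by rw [h]; exact Set.mem_insert _ _
  obtain ⟨h1, h2, h3⟩ := (mem_cells' _ _ _).1 hpμ
  have key : ∀ x y, (x, y) ∈ μ.cells → (x, y) ≠ (a, b) → (x, y) ∈ ν.cells := by
    intro x y hxy hne
    rw [h] at hxy
    exact hxy.resolve_left hne
  refine ⟨h1, ?_, ?_⟩
  · simp only
    by_contra hne
    have := key a (b + 1) ⟨h1, by simp, by simp only; omega⟩ (by simp)
    exact hp (cells_down this h1 h2 le_rfl (by omega))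
  · simp only
    by_contra hne
    have := key (a + 1) b ⟨by simp, h2, by simp only; omega⟩ (by simp)
    exact hp (cells_down this h1 h2 (by omega) le_rfl)

end Basics

section Hook

/-- No hook of length `t ℓ` with arm `t`. -/
def HookFree (ℓ : ℕ) (μ : YPartition) : Prop :=
  ∀ a b c d : ℕ, (a, b) ∈ μ.cells → (a, b + 1) ∉ μ.cells → (c, d) ∈ μ.cells →
    (c + 1, d) ∉ μ.cells → a < c + 1 → ladderIdx ℓ (a, b) ≠ ladderIdx ℓ (c + 1, d)

/-- Ladder key. -/
def lkey (ℓ : ℕ) (p : ℕ × ℕ) : ℕ ×ₗ ℕ := toLex (ladderIdx ℓ p, p.1)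

theorem ladderLE_iff (ℓ : ℕ) (p q : ℕ × ℕ) : LadderLE ℓ p q ↔ lkey ℓ p ≤ lkey ℓ q := by
  rw [lkey, lkey, Prod.Lex.toLex_le_toLex]; rfl

theorem lkey_lt_iff (ℓ : ℕ) (p q : ℕ × ℕ) : lkey ℓ p < lkey ℓ q ↔
    ladderIdx ℓ p < ladderIdx ℓ q ∨ (ladderIdx ℓ p = ladderIdx ℓ q ∧ p.1 < q.1) := by
  rw [lkey, lkey, Prod.Lex.toLex_lt_toLex]

/-- In a hook free partition, a removable box is never above an addable one on a ladder. -/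
theorem HookFree.sep {ℓ : ℕ} {μ : YPartition} (hH : HookFree ℓ μ) {r q : ℕ × ℕ}
    (hr : Removable μ r) (hq : Addable μ q) (hL : ladderIdx ℓ r = ladderIdx ℓ q) :
    q.1 ≤ r.1 := by
  by_contra hlt
  obtain ⟨a, b⟩ := r
  obtain ⟨c, d⟩ := q
  have h1 := hr.1
  simp only [not_le] at hlt h1
  have hqn := addable_not_mem hq
  have hq2 := (addable_pos hq).2
  obtain ⟨_, _, h3⟩ := hq
  simp only at h3 hq2
  obtain ⟨c, rfl⟩ : ∃ x, c = x + 1 := ⟨c - 1, by omega⟩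
  rcases h3 with h3 | h3
  · omega
  · exact hH a b c d (removable_mem hr) (removable_right hr) ⟨by simp only; omega, hq2, h3⟩
      hqn hlt hL

theorem HookFree.step {ℓ i : ℕ} (hℓ : 2 < ℓ) {lam mu : YPartition} (hH : HookFree ℓ lam)
    (hf : HatF ℓ i lam mu) : HookFree ℓ mu := by
  obtain ⟨n, ⟨hcon, hmax⟩, hmu⟩ := hf
  have hnA : Addable lam n := hcon.1.1
  have hnres : res ℓ n = i := hcon.1.2
  have hnn := addable_not_mem hnA
  -- extension principle
  have ext : ∀ q, Addable lam q → res ℓ q = i → lkey ℓ n < lkey ℓ q →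
      (∀ r, Removable lam r → res ℓ r = i → lkey ℓ n ≤ lkey ℓ r → lkey ℓ r ≤ lkey ℓ q →
        False) → False := by
    intro q hq hqi hnq hno
    have := conormal_ext _ _ (ladderLE_iff ℓ) _ _ (remRes_finite ℓ i lam) (addRes_finite ℓ i lam)
      n q hcon ⟨hq, hqi⟩ hnq.le (fun r hr h1 h2 => hno r hr.1 hr.2 h1 h2)
    have h2 := hmax q this
    rw [ladderLE_iff] at h2
    exact absurd h2 (not_le.2 hnq)
  have key : ∀ x y, (x, y) ∈ mu.cells → (x, y) ≠ n → (x, y) ∈ lam.cells := by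
    intro x y hxy hne
    rw [hmu] at hxy
    exact hxy.resolve_left hne
  have sub : ∀ x, x ∉ mu.cells → x ∉ lam.cells := by
    intro x hx hx'
    exact hx (by rw [hmu]; exact Set.mem_insert_of_mem _ hx')
  intro a b c d hp hpr hc hcd hac hL
  have hb := ((mem_cells' _ _ _).1 hp).2.1
  have hd := ((mem_cells' _ _ _).1 hc).2.1
  have ha := ((mem_cells' _ _ _).1 hp).1
  have hc1 := ((mem_cells' _ _ _).1 hc).1
  have hdb := L_row_lt ℓ hℓ a b (c + 1) d hb hd hL hac
  by_cases hpn : (a, b) = n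
  · -- first case
    have hcn : (c, d) ≠ n := by
      intro h
      rw [hpn, ← h, L_down] at hL
      omega
    have hc' := key c d hc hcn
    have hcd' := sub _ hcd
    have hqadd : Addable lam (c + 1, d) → False := by
      intro hq
      refine ext (c + 1, d) hq ?_ ?_ ?_
      · rw [← hnres, ← hpn]
        exact (res_congr ℓ hℓ _ _ hb hd hL).symm
      · rw [lkey_lt_iff, ← hpn]
        exact Or.inr ⟨hL, hac⟩
      · intro r hr _ h1 h2
        rw [← ladderLE_iff] at h1 h2
        have hLr : ladderIdx ℓ r = ladderIdx ℓ (c + 1, d) := by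
          rw [← hpn] at h1
          rcases h1 with h1 | h1 <;> rcases h2 with h2 | h2 <;> omega
        have hrow : r.1 ≤ c + 1 := by
          rcases h2 with h2 | h2
          · omega
          · exact h2.2
        have := hH.sep hr hq hLr
        simp only at this
        have hr1 : r.1 = c + 1 := by omega
        have hr2 : r.2 = d := by
          refine L_row_inj ℓ hℓ (c + 1) r.2 d (removable_mem hr).2.1 hd ?_
          rw [← hLr, ← hr1]
        apply hcd'
        rw [← hr1, ← hr2]
        exact removable_mem hr
    have hlt : lam.part (c + 1) < d := by
      by_contra h; exact hcd' ⟨by simp, hd, not_lt.1 h⟩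
    by_cases hleft : d = lam.part (c + 1) + 1
    · exact hqadd ⟨by simp, hleft, Or.inr hc'.2.2⟩
    · obtain ⟨d, rfl⟩ : ∃ x, d = x + 1 := ⟨d - 1, by omega⟩
      obtain ⟨b, rfl⟩ : ∃ x, b = x + 1 := ⟨b - 1, by omega⟩
      have hA := hnA.2.1
      rw [← hpn] at hA hnn
      simp only at hA
      refine hH a b c d ⟨ha, by simp only; omega, by simp only; omega⟩ hnn
        (cells_down hc' hc1 (by omega) le_rfl (by omega)) ?_ hac ?_
      · rintro ⟨_, _, h⟩
        simp only at h; omega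
      · rw [L_right _ _ _ (by omega), L_right _ _ _ (by omega)] at hL
        omega
  · have hp' := key a b hp hpn
    have hpr' := sub _ hpr
    have hcd' := sub _ hcd
    by_cases hcn : (c, d) = n
    · -- second case
      rw [L_down, hcn] at hL
      have hpa : lam.part a = b := by
        have h1 := hp'.2.2
        simp only at h1
        by_contra hne
        exact hpr' ⟨ha, by simp, by simp only; omega⟩
      have hnL : ∃ k, ladderIdx ℓ n = k := ⟨_, rfl⟩
      have hadd : Addable lam (a, b + 1) := by
        refine ⟨ha, by simp only; omega, ?_⟩
        simp only
        by_contra hcon2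
        push Not at hcon2
        obtain ⟨h1, h2⟩ := hcon2
        obtain ⟨a, rfl⟩ : ∃ x, a = x + 1 := ⟨a - 1, by omega⟩
        obtain ⟨c, rfl⟩ : ∃ x, c = x + 1 := ⟨c - 1, by omega⟩
        simp only [Nat.add_sub_cancel] at h2
        have hA3 := hnA.2.2
        rw [← hcn] at hA3 hnn
        simp only [Nat.add_sub_cancel] at hA3
        refine hH a b c d (cells_down hp' (by omega) hb (by omega) le_rfl) ?_
          ⟨by simp only; omega, hd, by simp only; omega⟩ hnn (by omega) ?_
        · rintro ⟨_, _, h⟩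
          simp only at h; omega
        · rw [hcn]
          rw [L_down] at hL
          omega
      have hLp : ladderIdx ℓ n + ℓ = ladderIdx ℓ (a, b + 1) := by
        rw [L_right _ _ _ hb]; omega
      have hn2 := (addable_pos hnA).2
      have hresp : res ℓ (a, b + 1) = i := by
        rw [← hnres]
        exact (res_congr_add ℓ hℓ n _ hn2 (by simp) hLp).symm
      refine ext (a, b + 1) hadd hresp ?_ ?_
      · rw [lkey_lt_iff]; left; omega
      · intro r hr hri h1 h2
        rw [← ladderLE_iff] at h1 h2
        have hr2 := (removable_mem hr).2.1
        have hrn : r ≠ n := fun h => hnn (h ▸ removable_mem hr)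
        by_cases hLr : ladderIdx ℓ n = ladderIdx ℓ r
        · have hrow : n.1 ≤ r.1 := by
            rcases h1 with h1 | h1
            · omega
            · exact h1.2
          rw [← hcn] at hrow
          simp only at hrow
          refine hH a b r.1 r.2 hp' hpr' (removable_mem hr) (removable_down hr) (by omega) ?_
          rw [L_down]
          simp only [Prod.mk.eta]
          omega
        · have hLr' : ladderIdx ℓ n < ladderIdx ℓ r := by
            rcases h1 with h1 | h1 <;> omega
          have := res_gap ℓ hℓ n r hn2 hr2 (hnres.trans hri.symm) hLr'
          have hLr2 : ladderIdx ℓ r = ladderIdx ℓ (a, b + 1) := by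
            rcases h2 with h2 | h2 <;> omega
          have hrow : r.1 ≤ a := by
            rcases h2 with h2 | h2
            · omega
            · exact h2.2
          have h3 := hH.sep hr hadd hLr2
          simp only at h3
          have hr1 : r.1 = a := by omega
          have hr3 : r.2 = b + 1 := by
            refine L_row_inj ℓ hℓ a r.2 (b + 1) hr2 (by omega) ?_
            rw [← hLr2, ← hr1]
          apply hpr'
          rw [← hr1, ← hr3]
          exact removable_mem hr
    · exact hH a b c d hp' hpr' (key c d hc hcn) hcd' hac hL

theorem HookFree.node {ℓ : ℕ} (hℓ : 2 < ℓ) {lam : YPartition} (h : LadderNode ℓ lam) :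
    HookFree ℓ lam := by
  unfold LadderNode at h
  induction h with
  | refl =>
    intro a b c d h
    have h1 := h.2.1
    have h2 : b ≤ 0 := h.2.2
    simp only at h1
    omega
  | tail _ hs ih =>
    obtain ⟨j, _, hj⟩ := hs
    exact ih.step hℓ hj

end Hook

section Regular

theorem top_mem {ℓ : ℕ} (hℓ : 2 < ℓ) {ρ : YPartition} (hT : TopJustified ℓ ρ) {a b c d : ℕ}
    (hz : (c, d) ∈ ρ.cells) (ha : 1 ≤ a) (hb : 1 ≤ b)
    (hL : ladderIdx ℓ (a, b) = ladderIdx ℓ (c, d)) (hac : a ≤ c) : (a, b) ∈ ρ.cells := by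
  rcases hac.lt_or_eq with h | h
  · exact hT _ hz _ ha hb hL h
  · subst h
    rw [L_row_inj ℓ hℓ a b d hb hz.2.1 hL]
    exact hz

theorem reg_bound {ℓ : ℕ} (hℓ : 2 < ℓ) {ρ : YPartition} (hT : TopJustified ℓ ρ) {a b c d : ℕ}
    (hb : 1 ≤ b) (hx : (a + 1, b) ∉ ρ.cells) (hz : (c, d) ∈ ρ.cells) (hac : a + 1 ≤ c) :
    ladderIdx ℓ (c, d) ≤ ladderIdx ℓ (a, b) := by
  by_contra hlt
  rw [not_le] at hlt
  have hd := ((mem_cells' _ _ _).1 hz).2.1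
  obtain ⟨D, hD⟩ : ∃ D, ladderIdx ℓ (c, d) = ladderIdx ℓ (a + 1, b) + D :=
    ⟨ladderIdx ℓ (c, d) - ladderIdx ℓ (a + 1, b), by rw [L_down]; omega⟩
  have he : 0 < ℓ - 1 := by omega
  obtain ⟨e, hee⟩ : ∃ e, ℓ - 1 = e := ⟨_, rfl⟩
  have hdm := Nat.div_add_mod D e
  have hs : D % e < e := Nat.mod_lt _ (by omega)
  obtain ⟨m, hm⟩ : ∃ m, D / e = m := ⟨_, rfl⟩
  obtain ⟨s, hs'⟩ : ∃ s, D % e = s := ⟨_, rfl⟩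
  rw [hm, hs'] at hdm
  rw [hs'] at hs
  obtain ⟨b, rfl⟩ : ∃ x, b = x + 1 := ⟨b - 1, by omega⟩
  obtain ⟨d, rfl⟩ : ∃ x, d = x + 1 := ⟨d - 1, by omega⟩
  simp only [ladderIdx, hee, Nat.add_sub_cancel] at hD
  have heq : c + e * d = a + 1 + e * (b + m) + s := by rw [mul_add]; omega
  have hcs : a + 1 + s ≤ c := by
    by_contra hcon
    have h1 : b + m < d := by
      by_contra h2
      have := Nat.mul_le_mul_left e (not_lt.1 h2)
      omega
    have := Nat.mul_le_mul_left e (show b + m + 1 ≤ d from h1)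
    rw [mul_add e (b + m) 1] at this
    omega
  apply hx
  refine cells_down (c := a + 1) (d := b + m + 1) ?_ (by omega) (by omega) le_rfl (by omega)
  refine top_mem hℓ hT (c := c - s) (d := d + 1)
    (cells_down hz (by omega) (by omega) (by omega) le_rfl) (by omega) (by omega) ?_ (by omega)
  simp only [ladderIdx, hee, Nat.add_sub_cancel]
  omega

/-- A mark: an addable or removable box. -/
def Mark (μ : YPartition) (p : ℕ × ℕ) : Prop := Addable μ p ∨ Removable μ p

theorem reg_rows {ℓ : ℕ} (hℓ : 2 < ℓ) {ρ : YPartition} (hT : TopJustified ℓ ρ) {x y : ℕ × ℕ}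
    (hx : Mark ρ x) (hy : Mark ρ y) (hres : res ℓ x = res ℓ y)
    (hL : ladderIdx ℓ x < ladderIdx ℓ y) : y.1 < x.1 := by
  obtain ⟨a, b⟩ := x
  obtain ⟨c, d⟩ := y
  have hb : 1 ≤ b := hx.elim (fun h => (addable_pos h).2) (fun h => (removable_mem h).2.1)
  have hd : 1 ≤ d := hy.elim (fun h => (addable_pos h).2) (fun h => (removable_mem h).2.1)
  have ha : 1 ≤ a := hx.elim (fun h => h.1) (fun h => h.1)
  have hxd : (a + 1, b) ∉ ρ.cells := by
    rcases hx with h | h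
    · intro hm
      exact addable_not_mem h (cells_down hm ha hb (by omega) le_rfl)
    · exact removable_down h
  have hgap := res_gap ℓ hℓ _ _ hb hd hres hL
  by_contra hcon
  simp only [not_lt] at hcon
  rcases hcon.lt_or_eq with hac | hac
  · rcases hy with h | h
    · obtain ⟨h1, h2, h3⟩ := h
      simp only at h1 h2 h3
      by_cases hd1 : d = 1
      · subst hd1
        have h4 : (c - 1, 1) ∈ ρ.cells := ⟨by simp only; omega, le_rfl, by simp only; omega⟩
        obtain ⟨c, rfl⟩ : ∃ x, c = x + 1 := ⟨c - 1, by omega⟩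
        rw [L_down] at hgap
        by_cases hca : c = a
        · subst hca
          obtain ⟨b, rfl⟩ : ∃ x, b = x + 1 := ⟨b - 1, by omega⟩
          simp only [ladderIdx] at hgap
          omega
        · have := reg_bound hℓ hT hb hxd h4 (by omega)
          simp only [Nat.add_sub_cancel] at this
          omega
      · obtain ⟨d, rfl⟩ : ∃ x, d = x + 1 := ⟨d - 1, by omega⟩
        have := reg_bound hℓ hT (c := c) (d := d) hb hxd
          ⟨h1, by simp only; omega, by simp only; omega⟩ (by omega)
        rw [L_right _ _ _ (by omega)] at hgap
        omega
    · have := reg_bound hℓ hT hb hxd (removable_mem h) hac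
      omega
  · subst hac
    have e1 : b = ρ.part a ∨ b = ρ.part a + 1 :=
      hx.elim (fun h => Or.inr h.2.1) (fun h => Or.inl h.2.1)
    have e2 : d = ρ.part a ∨ d = ρ.part a + 1 :=
      hy.elim (fun h => Or.inr h.2.1) (fun h => Or.inl h.2.1)
    have hdb : d ≤ b + 1 := by omega
    have : ladderIdx ℓ (a, d) ≤ ladderIdx ℓ (a, b) + (ℓ - 1) := by
      rw [← L_right _ _ _ hb]
      simp only [ladderIdx]
      have := Nat.mul_le_mul_left (ℓ - 1) (show d - 1 ≤ b + 1 - 1 by omega)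
      omega
    omega

end Regular

section Chars

/-- Numerical condition: block `k` contains a conormal box. -/
def CondF (ℓ i : ℕ) (μ : YPartition) (k : ℕ) : Prop :=
  ∀ j ≤ k, (RemovableRes ℓ i μ ∩ {s | j ≤ ladderIdx ℓ s + ℓ ∧ ladderIdx ℓ s + ℓ ≤ k}).ncard <
    (AddableRes ℓ i μ ∩ {s | j ≤ ladderIdx ℓ s ∧ ladderIdx ℓ s ≤ k}).ncard

/-- Numerical condition: block `k` contains a normal box. -/
def CondE (ℓ i : ℕ) (μ : YPartition) (k : ℕ) : Prop :=
  ∀ j, k ≤ j → (AddableRes ℓ i μ ∩ {s | k ≤ ladderIdx ℓ s ∧ ladderIdx ℓ s ≤ j}).ncard <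
    (RemovableRes ℓ i μ ∩ {s | k ≤ ladderIdx ℓ s + ℓ ∧ ladderIdx ℓ s + ℓ ≤ j}).ncard

theorem le_of_block {ℓ i : ℕ} (hℓ : 2 < ℓ) {μ : YPartition} {x y : ℕ × ℕ}
    (hx : x ∈ AddableRes ℓ i μ) (hy : y ∈ RemovableRes ℓ i μ)
    (h : ladderIdx ℓ x < ladderIdx ℓ y + ℓ) : ladderIdx ℓ x ≤ ladderIdx ℓ y := by
  by_contra hlt
  have := res_gap ℓ hℓ y x (removable_mem hy.1).2.1 (addable_pos hx.1).2 (hy.2.trans hx.2.symm)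
    (not_le.1 hlt)
  omega

theorem hook_AR {ℓ i : ℕ} (hℓ : 2 < ℓ) {μ : YPartition} (hH : HookFree ℓ μ) :
    ∀ x ∈ AddableRes ℓ i μ, ∀ y ∈ RemovableRes ℓ i μ,
      ladderIdx ℓ x < ladderIdx ℓ y + ℓ → lkey ℓ x < lkey ℓ y := by
  intro x hx y hy h
  rw [lkey_lt_iff]
  rcases (le_of_block hℓ hx hy h).lt_or_eq with h1 | h1
  · exact Or.inl h1
  · refine Or.inr ⟨h1, ?_⟩
    have h2 := hH.sep hy.1 hx.1 h1.symm
    rcases h2.lt_or_eq with h3 | h3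
    · exact h3
    · exfalso
      obtain ⟨a, b⟩ := x
      obtain ⟨c, d⟩ := y
      simp only at h3
      subst h3
      have := L_row_inj ℓ hℓ a b d (addable_pos hx.1).2 (removable_mem hy.1).2.1 h1
      subst this
      exact addable_not_mem hx.1 (removable_mem hy.1)

theorem hook_charF {ℓ i : ℕ} (hℓ : 2 < ℓ) {μ : YPartition} (hH : HookFree ℓ μ) (k : ℕ) :
    (∃ q, LadderConormal ℓ i μ q ∧ ladderIdx ℓ q = k) ↔ CondF ℓ i μ k := by
  refine conormal_char (LadderLE ℓ) (lkey ℓ) (ladderLE_iff ℓ) _ _ (remRes_finite ℓ i μ)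
    (addRes_finite ℓ i μ) (fun s => ladderIdx ℓ s + ℓ) (ladderIdx ℓ) ?_ ?_ ?_ (hook_AR hℓ hH) k
  · intro x _ y _ h
    rw [lkey_lt_iff]; exact Or.inl h
  · intro x _ y _ h
    rw [lkey_lt_iff]; left; omega
  · intro x _ y _ h
    rw [lkey_lt_iff]; left; omega

theorem hook_charE {ℓ i : ℕ} (hℓ : 2 < ℓ) {μ : YPartition} (hH : HookFree ℓ μ) (k : ℕ) :
    (∃ q, LadderNormal ℓ i μ q ∧ ladderIdx ℓ q + ℓ = k) ↔ CondE ℓ i μ k := by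
  refine normal_char (LadderLE ℓ) (lkey ℓ) (ladderLE_iff ℓ) _ _ (remRes_finite ℓ i μ)
    (addRes_finite ℓ i μ) (fun s => ladderIdx ℓ s + ℓ) (ladderIdx ℓ) ?_ ?_ ?_ (hook_AR hℓ hH) k
  · intro x _ y _ h
    rw [lkey_lt_iff]; exact Or.inl h
  · intro x _ y _ h
    rw [lkey_lt_iff]; left; omega
  · intro x _ y _ h
    rw [lkey_lt_iff]; left; omega

/-- Row key. -/
def rkey (p : ℕ × ℕ) : ℕᵒᵈ := OrderDual.toDual p.1

theorem rowLE_iff (p q : ℕ × ℕ) : RowLE p q ↔ rkey p ≤ rkey q := Iff.rfl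

theorem rkey_lt_iff (p q : ℕ × ℕ) : rkey p < rkey q ↔ q.1 < p.1 := Iff.rfl

theorem reg_AR {ℓ i : ℕ} (hℓ : 2 < ℓ) {μ : YPartition} (hT : TopJustified ℓ μ) :
    ∀ x ∈ AddableRes ℓ i μ, ∀ y ∈ RemovableRes ℓ i μ,
      ladderIdx ℓ x < ladderIdx ℓ y + ℓ → rkey x < rkey y := by
  intro x hx y hy h
  rw [rkey_lt_iff]
  rcases (le_of_block hℓ hx hy h).lt_or_eq with h1 | h1
  · exact reg_rows hℓ hT (Or.inl hx.1) (Or.inr hy.1) (hx.2.trans hy.2.symm) h1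
  · by_contra hlt
    exact addable_not_mem hx.1 (top_mem hℓ hT (a := x.1) (b := x.2) (c := y.1) (d := y.2)
      (removable_mem hy.1) hx.1.1 (addable_pos hx.1).2 h1 (not_lt.1 hlt))

theorem reg_charF {ℓ i : ℕ} (hℓ : 2 < ℓ) {μ : YPartition} (hT : TopJustified ℓ μ) (k : ℕ) :
    (∃ q, ClassConormal ℓ i μ q ∧ ladderIdx ℓ q = k) ↔ CondF ℓ i μ k := by
  refine conormal_char RowLE rkey rowLE_iff _ _ (remRes_finite ℓ i μ)
    (addRes_finite ℓ i μ) (fun s => ladderIdx ℓ s + ℓ) (ladderIdx ℓ) ?_ ?_ ?_ (reg_AR hℓ hT) k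
  · intro x hx y hy h
    exact reg_rows hℓ hT (Or.inl hx.1) (Or.inl hy.1) (hx.2.trans hy.2.symm) h
  · intro x hx y hy h
    exact reg_rows hℓ hT (Or.inr hx.1) (Or.inr hy.1) (hx.2.trans hy.2.symm) (by omega)
  · intro x hx y hy h
    exact reg_rows hℓ hT (Or.inr hx.1) (Or.inl hy.1) (hx.2.trans hy.2.symm) (by omega)

theorem reg_charE {ℓ i : ℕ} (hℓ : 2 < ℓ) {μ : YPartition} (hT : TopJustified ℓ μ) (k : ℕ) :
    (∃ q, ClassNormal ℓ i μ q ∧ ladderIdx ℓ q + ℓ = k) ↔ CondE ℓ i μ k := by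
  refine normal_char RowLE rkey rowLE_iff _ _ (remRes_finite ℓ i μ)
    (addRes_finite ℓ i μ) (fun s => ladderIdx ℓ s + ℓ) (ladderIdx ℓ) ?_ ?_ ?_ (reg_AR hℓ hT) k
  · intro x hx y hy h
    exact reg_rows hℓ hT (Or.inl hx.1) (Or.inl hy.1) (hx.2.trans hy.2.symm) h
  · intro x hx y hy h
    exact reg_rows hℓ hT (Or.inr hx.1) (Or.inr hy.1) (hx.2.trans hy.2.symm) (by omega)
  · intro x hx y hy h
    exact reg_rows hℓ hT (Or.inr hx.1) (Or.inl hy.1) (hx.2.trans hy.2.symm) (by omega)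

end Chars

section Counting

open Classical in
/-- All positions on ladder `m` as a finset. -/
def posF (ℓ m : ℕ) : Finset (ℕ × ℕ) :=
  (Finset.range (m + 1) ×ˢ Finset.range (m + 1)).filter
    fun p => 1 ≤ p.1 ∧ 1 ≤ p.2 ∧ ladderIdx ℓ p = m

theorem mem_posF {ℓ m : ℕ} (hℓ : 2 < ℓ) (p : ℕ × ℕ) :
    p ∈ posF ℓ m ↔ 1 ≤ p.1 ∧ 1 ≤ p.2 ∧ ladderIdx ℓ p = m := by
  simp only [posF, Finset.mem_filter, Finset.mem_product, Finset.mem_range, and_iff_right_iff_imp]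
  rintro ⟨h1, h2, h3⟩
  have := Nat.le_mul_of_pos_left (p.2 - 1) (show 0 < ℓ - 1 by omega)
  simp only [ladderIdx] at h3
  omega

open Classical in
theorem ncard_shift {ℓ m : ℕ} (hℓ : 2 < ℓ) (T : Set (ℕ × ℕ)) (u v : ℕ)
    (Q : ℕ × ℕ → Prop)
    (h1 : ∀ a b, (a, b) ∈ T → 1 ≤ a ∧ 1 ≤ b ∧ ladderIdx ℓ (a + u, b + v) = m ∧ Q (a + u, b + v))
    (h2 : ∀ a b, 1 ≤ a → 1 ≤ b → ladderIdx ℓ (a, b) = m → Q (a, b) →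
      u ≤ a ∧ v ≤ b ∧ (a - u, b - v) ∈ T) :
    T.ncard = ∑ p ∈ posF ℓ m, if Q p then 1 else 0 := by
  rw [← Finset.card_filter, ← Set.ncard_coe_finset]
  have hinj : Function.Injective (fun p : ℕ × ℕ => (p.1 + u, p.2 + v)) := by
    rintro ⟨a, b⟩ ⟨c, d⟩ h
    simp only [Prod.mk.injEq] at h ⊢
    omega
  rw [← Set.ncard_image_of_injective T hinj]
  congr 1
  ext ⟨a, b⟩
  simp only [Set.mem_image, Prod.exists, Prod.mk.injEq, Finset.coe_filter, mem_posF hℓ]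
  constructor
  · rintro ⟨x, y, hxy, rfl, rfl⟩
    obtain ⟨g1, g2, g3, g4⟩ := h1 x y hxy
    exact ⟨⟨by simp only; omega, by simp only; omega, g3⟩, g4⟩
  · rintro ⟨⟨g1, g2, g3⟩, g4⟩
    obtain ⟨e1, e2, e3⟩ := h2 a b g1 g2 g3 g4
    exact ⟨_, _, e3, by omega, by omega⟩

theorem L_diag {ℓ : ℕ} (hℓ : 2 < ℓ) (a b : ℕ) (hb : 1 ≤ b) :
    ladderIdx ℓ (a + 1, b + 1) = ladderIdx ℓ (a, b) + ℓ := by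
  rw [L_down, L_right _ _ _ hb]; omega

theorem block_count {ℓ : ℕ} (hℓ : 2 < ℓ) (μ : YPartition) (m : ℕ) :
    ({p | Addable μ p} ∩ {p | ladderIdx ℓ p = m}).ncard
      + (μ.cells ∩ {p | ladderIdx ℓ p + 0 = m}).ncard
      + (μ.cells ∩ {p | ladderIdx ℓ p + ℓ = m}).ncard =
    ({p | Removable μ p} ∩ {p | ladderIdx ℓ p + ℓ = m}).ncard
      + (μ.cells ∩ {p | ladderIdx ℓ p + 1 = m}).ncard
      + (μ.cells ∩ {p | ladderIdx ℓ p + (ℓ - 1) = m}).ncard + (if m = 1 then 1 else 0) := by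
  classical
  rw [ncard_shift hℓ (m := m) ({p | Addable μ p} ∩ {p | ladderIdx ℓ p = m}) 0 0
    (fun p => p.2 = μ.part p.1 + 1 ∧ (p.1 = 1 ∨ p.2 ≤ μ.part (p.1 - 1))),
    ncard_shift hℓ (m := m) (μ.cells ∩ {p | ladderIdx ℓ p + 0 = m}) 0 0
    (fun p => p.2 ≤ μ.part p.1),
    ncard_shift hℓ (m := m) (μ.cells ∩ {p | ladderIdx ℓ p + ℓ = m}) 1 1
    (fun p => 2 ≤ p.1 ∧ 2 ≤ p.2 ∧ p.2 - 1 ≤ μ.part (p.1 - 1)),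
    ncard_shift hℓ (m := m) ({p | Removable μ p} ∩ {p | ladderIdx ℓ p + ℓ = m}) 1 1
    (fun p => 2 ≤ p.1 ∧ p.2 - 1 = μ.part (p.1 - 1) ∧ μ.part p.1 < p.2 - 1),
    ncard_shift hℓ (m := m) (μ.cells ∩ {p | ladderIdx ℓ p + 1 = m}) 1 0
    (fun p => 2 ≤ p.1 ∧ p.2 ≤ μ.part (p.1 - 1)),
    ncard_shift hℓ (m := m) (μ.cells ∩ {p | ladderIdx ℓ p + (ℓ - 1) = m}) 0 1
    (fun p => 2 ≤ p.2 ∧ p.2 - 1 ≤ μ.part p.1)]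
  · have hcorner : (if m = 1 then 1 else 0) =
        ∑ p ∈ posF ℓ m, if p = (1, 1) then 1 else 0 := by
      rw [Finset.sum_ite_eq']
      congr 1
      simp only [mem_posF hℓ, ladderIdx, eq_iff_iff]
      simp [eq_comm]
    rw [hcorner, ← Finset.sum_add_distrib, ← Finset.sum_add_distrib, ← Finset.sum_add_distrib,
      ← Finset.sum_add_distrib, ← Finset.sum_add_distrib]
    refine Finset.sum_congr rfl ?_
    rintro ⟨a, b⟩ hp
    obtain ⟨ha, hb, _⟩ := (mem_posF hℓ _).1 hp
    simp only at ha hb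
    simp only [Prod.mk.injEq]
    by_cases ha1 : a = 1
    · subst ha1
      have := μ.zero_at_zero
      simp only [Nat.sub_self, this]
      clear hcorner hp this
      have h21 : ¬ (2 ≤ 1) := by omega
      simp only [true_or, and_true, true_and, h21, false_and, if_false]
      generalize μ.part 1 = w
      obtain ⟨b, rfl⟩ : ∃ x, b = x + 1 := ⟨b - 1, by omega⟩
      simp only [Nat.add_sub_cancel]
      by_cases c1 : b = w
      · by_cases c2 : b = 0
        · rw [if_pos (by omega), if_neg (by omega), if_neg (by omega), if_pos (by omega)]
        · rw [if_pos (by omega), if_neg (by omega), if_pos (by omega), if_neg (by omega)]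
      · by_cases c3 : b < w
        · by_cases c2 : b = 0
          · rw [if_neg (by omega), if_pos (by omega), if_neg (by omega), if_pos (by omega)]
          · rw [if_neg (by omega), if_pos (by omega), if_pos (by omega), if_neg (by omega)]
        · rw [if_neg (by omega), if_neg (by omega), if_neg (by omega), if_neg (by omega)]
    · have := part_le (μ := μ) (show 1 ≤ a - 1 by omega) (show a - 1 ≤ a by omega)
      split_ifs <;> omega
  · rintro a b ⟨⟨h1, h2, h3⟩, h4⟩
    have h4 : ladderIdx ℓ (a, b) + (ℓ - 1) = m := h4
    simp only at h1 h2 h3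
    refine ⟨h1, h2, ?_, ?_⟩
    · rw [← h4, add_zero, L_right _ _ _ h2]
    · simp only [add_zero]; omega
  · rintro a b ha hb h ⟨h1, h2⟩
    simp only at h1 h2
    obtain ⟨b, rfl⟩ : ∃ x, b = x + 1 := ⟨b - 1, by omega⟩
    rw [L_right _ _ _ (by omega)] at h
    exact ⟨by omega, by omega, ⟨ha, by simp only; omega, by simp only; omega⟩, h⟩
  · rintro a b ⟨⟨h1, h2, h3⟩, h4⟩
    have h4 : ladderIdx ℓ (a, b) + 1 = m := h4
    simp only at h1 h2 h3
    refine ⟨h1, h2, ?_, ?_⟩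
    · rw [← h4, add_zero, L_down]
    · simp only [add_zero, Nat.add_sub_cancel]; omega
  · rintro a b ha hb h ⟨h1, h2⟩
    simp only at h1 h2
    obtain ⟨a, rfl⟩ : ∃ x, a = x + 1 := ⟨a - 1, by omega⟩
    rw [L_down] at h
    exact ⟨by omega, by omega, ⟨by simp only; omega, hb, h2⟩, h⟩
  · rintro a b ⟨⟨h1, h2, h3⟩, h4⟩
    have h4 : ladderIdx ℓ (a, b) + ℓ = m := h4
    simp only at h1 h2 h3
    refine ⟨h1, by omega, ?_, ?_⟩
    · rw [← h4, L_diag hℓ _ _ (by omega)]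
    · simp only [Nat.add_sub_cancel]; omega
  · rintro a b ha hb h ⟨h1, h2, h3⟩
    simp only at h1 h2 h3
    obtain ⟨a, rfl⟩ : ∃ x, a = x + 1 := ⟨a - 1, by omega⟩
    obtain ⟨b, rfl⟩ : ∃ x, b = x + 1 := ⟨b - 1, by omega⟩
    rw [L_diag hℓ _ _ (by omega)] at h
    exact ⟨by omega, by omega, ⟨by simp only; omega, h2, h3⟩, h⟩
  · rintro a b ⟨⟨h1, h2, h3⟩, h4⟩
    have h4 : ladderIdx ℓ (a, b) + ℓ = m := h4
    simp only at h1 h2 h3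
    refine ⟨h1, by omega, ?_, ?_⟩
    · rw [← h4, L_diag hℓ _ _ (by omega)]
    · simp only [Nat.add_sub_cancel]; omega
  · rintro a b ha hb h ⟨h1, h2, h3⟩
    simp only at h1 h2 h3
    obtain ⟨a, rfl⟩ : ∃ x, a = x + 1 := ⟨a - 1, by omega⟩
    obtain ⟨b, rfl⟩ : ∃ x, b = x + 1 := ⟨b - 1, by omega⟩
    rw [L_diag hℓ _ _ (by omega)] at h
    exact ⟨by omega, by omega, ⟨by simp only; omega, by simp only; omega, h3⟩, h⟩
  · rintro a b ⟨⟨h1, h2, h3⟩, h4⟩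
    exact ⟨h1, h2, h4, h3⟩
  · rintro a b ha hb h h1
    exact ⟨by omega, by omega, ⟨ha, hb, h1⟩, h⟩
  · rintro a b ⟨h0, h4⟩
    exact ⟨h0.1, (addable_pos h0).2, h4, h0.2⟩
  · rintro a b ha hb h h1
    exact ⟨by omega, by omega, ⟨ha, h1⟩, h⟩

theorem shift_inv {ℓ : ℕ} {lam mu : YPartition} (h : SameRegClass ℓ lam mu) (s m : ℕ) :
    (lam.cells ∩ {p | ladderIdx ℓ p + s = m}).ncard =
      (mu.cells ∩ {p | ladderIdx ℓ p + s = m}).ncard := by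
  by_cases hs : s ≤ m
  · have e : {p | ladderIdx ℓ p + s = m} = {p | ladderIdx ℓ p = m - s} := by
      ext p
      change ladderIdx ℓ p + s = m ↔ ladderIdx ℓ p = m - s
      omega
    rw [e]
    exact h (m - s)
  · have e : {p | ladderIdx ℓ p + s = m} = ∅ := by
      refine Set.eq_empty_iff_forall_notMem.2 ?_
      intro p hp
      have hp : ladderIdx ℓ p + s = m := hp
      omega
    rw [e, Set.inter_empty, Set.inter_empty]

theorem addRes_block {ℓ : ℕ} (hℓ : 2 < ℓ) (i m : ℕ) (μ : YPartition) :
    AddableRes ℓ i μ ∩ {p | ladderIdx ℓ p = m} =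
      if ((1 - (m : ℤ)) % (ℓ : ℤ)).toNat = i then {p | Addable μ p} ∩ {p | ladderIdx ℓ p = m}
      else ∅ := by
  split_ifs with h
  · ext p
    constructor
    · rintro ⟨⟨h1, _⟩, h3⟩
      exact ⟨h1, h3⟩
    · rintro ⟨h1, h3⟩
      have h3' : ladderIdx ℓ p = m := h3
      exact ⟨⟨h1, by rw [res_eq ℓ hℓ p (addable_pos h1).2, h3', h]⟩, h3⟩
  · rw [Set.eq_empty_iff_forall_notMem]
    rintro p ⟨⟨h1, h2⟩, h3⟩
    have h3' : ladderIdx ℓ p = m := h3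
    rw [res_eq ℓ hℓ p (addable_pos h1).2, h3'] at h2
    exact h h2

theorem remRes_block {ℓ : ℕ} (hℓ : 2 < ℓ) (i m : ℕ) (μ : YPartition) :
    RemovableRes ℓ i μ ∩ {p | ladderIdx ℓ p + ℓ = m} =
      if ((1 - (m : ℤ)) % (ℓ : ℤ)).toNat = i
      then {p | Removable μ p} ∩ {p | ladderIdx ℓ p + ℓ = m}
      else ∅ := by
  have key : ∀ p, Removable μ p → ladderIdx ℓ p + ℓ = m →
      res ℓ p = ((1 - (m : ℤ)) % (ℓ : ℤ)).toNat := by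
    intro p hp h
    rw [res_eq ℓ hℓ p (removable_mem hp).2.1, ← h]
    push_cast
    have : (1 - ((ladderIdx ℓ p : ℤ) + ℓ)) = (1 - (ladderIdx ℓ p : ℤ)) + ℓ * (-1) := by ring
    rw [this, Int.add_mul_emod_self_left]
  split_ifs with h
  · ext p
    constructor
    · rintro ⟨⟨h1, _⟩, h3⟩
      exact ⟨h1, h3⟩
    · rintro ⟨h1, h3⟩
      exact ⟨⟨h1, (key p h1 h3).trans h⟩, h3⟩
  · rw [Set.eq_empty_iff_forall_notMem]
    rintro p ⟨⟨h1, h2⟩, h3⟩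
    exact h ((key p h1 h3).symm.trans h2)

theorem block_inv {ℓ : ℕ} (hℓ : 2 < ℓ) (i m : ℕ) {lam mu : YPartition}
    (h : SameRegClass ℓ lam mu) :
    (AddableRes ℓ i lam ∩ {p | ladderIdx ℓ p = m}).ncard
      + (RemovableRes ℓ i mu ∩ {p | ladderIdx ℓ p + ℓ = m}).ncard =
    (AddableRes ℓ i mu ∩ {p | ladderIdx ℓ p = m}).ncard
      + (RemovableRes ℓ i lam ∩ {p | ladderIdx ℓ p + ℓ = m}).ncard := by
  rw [addRes_block hℓ, addRes_block hℓ, remRes_block hℓ, remRes_block hℓ]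
  split_ifs with hi
  · have h1 := block_count hℓ lam m
    have h2 := block_count hℓ mu m
    rw [shift_inv h, shift_inv h, shift_inv h, shift_inv h] at h1
    omega
  · rfl

theorem ncard_blocks (S : Set (ℕ × ℕ)) (hS : S.Finite) (B : ℕ × ℕ → ℕ) (j k : ℕ) :
    (S ∩ {s | j ≤ B s ∧ B s ≤ k}).ncard =
      ∑ m ∈ Finset.Icc j k, (S ∩ {s | B s = m}).ncard := by
  classical
  obtain ⟨F, rfl⟩ := hS.exists_finset_coe
  have e1 : (F : Set (ℕ × ℕ)) ∩ {s | j ≤ B s ∧ B s ≤ k} =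
      ((F.filter fun s => j ≤ B s ∧ B s ≤ k : Finset (ℕ × ℕ)) : Set (ℕ × ℕ)) := by
    ext s; simp
  have e2 : ∀ m, (F : Set (ℕ × ℕ)) ∩ {s | B s = m} =
      ((F.filter fun s => B s = m : Finset (ℕ × ℕ)) : Set (ℕ × ℕ)) := by
    intro m; ext s; simp
  simp only [e1, e2, Set.ncard_coe_finset]
  rw [Finset.card_eq_sum_card_fiberwise (f := B) (t := Finset.Icc j k)]
  · refine Finset.sum_congr rfl fun m hm => ?_
    rw [Finset.mem_Icc] at hm
    congr 1
    ext s
    simp only [Finset.mem_filter]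
    constructor
    · rintro ⟨⟨h1, _⟩, h2⟩
      exact ⟨h1, h2⟩
    · rintro ⟨h1, h2⟩
      exact ⟨⟨h1, by omega⟩, h2⟩
  · intro s hs
    simp only [Finset.coe_filter] at hs
    exact Finset.mem_coe.2 (Finset.mem_Icc.2 hs.2)

theorem interval_inv {ℓ : ℕ} (hℓ : 2 < ℓ) (i j k : ℕ) {lam mu : YPartition}
    (h : SameRegClass ℓ lam mu) :
    (AddableRes ℓ i lam ∩ {p | j ≤ ladderIdx ℓ p ∧ ladderIdx ℓ p ≤ k}).ncard
      + (RemovableRes ℓ i mu ∩ {p | j ≤ ladderIdx ℓ p + ℓ ∧ ladderIdx ℓ p + ℓ ≤ k}).ncard =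
    (AddableRes ℓ i mu ∩ {p | j ≤ ladderIdx ℓ p ∧ ladderIdx ℓ p ≤ k}).ncard
      + (RemovableRes ℓ i lam ∩ {p | j ≤ ladderIdx ℓ p + ℓ ∧ ladderIdx ℓ p + ℓ ≤ k}).ncard := by
  rw [ncard_blocks _ (addRes_finite ℓ i lam) (ladderIdx ℓ),
    ncard_blocks _ (addRes_finite ℓ i mu) (ladderIdx ℓ),
    ncard_blocks _ (remRes_finite ℓ i lam) (fun p => ladderIdx ℓ p + ℓ),
    ncard_blocks _ (remRes_finite ℓ i mu) (fun p => ladderIdx ℓ p + ℓ),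
    ← Finset.sum_add_distrib, ← Finset.sum_add_distrib]
  exact Finset.sum_congr rfl fun m _ => block_inv hℓ i m h

theorem condF_inv {ℓ : ℕ} (hℓ : 2 < ℓ) (i k : ℕ) {lam mu : YPartition}
    (h : SameRegClass ℓ lam mu) : CondF ℓ i lam k ↔ CondF ℓ i mu k := by
  unfold CondF
  refine forall₂_congr fun j _ => ?_
  have := interval_inv hℓ i j k h
  omega

theorem condE_inv {ℓ : ℕ} (hℓ : 2 < ℓ) (i k : ℕ) {lam mu : YPartition}
    (h : SameRegClass ℓ lam mu) : CondE ℓ i lam k ↔ CondE ℓ i mu k := by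
  unfold CondE
  refine forall₂_congr fun j _ => ?_
  have := interval_inv hℓ i k j h
  omega

end Counting

section Final

theorem top_mem' {ℓ : ℕ} (hℓ : 2 < ℓ) {ρ : YPartition} (hT : TopJustified ℓ ρ) {x z : ℕ × ℕ}
    (hz : z ∈ ρ.cells) (h1 : 1 ≤ x.1) (h2 : 1 ≤ x.2)
    (hL : ladderIdx ℓ x = ladderIdx ℓ z) (hac : x.1 ≤ z.1) : x ∈ ρ.cells := by
  obtain ⟨a, b⟩ := x
  obtain ⟨c, d⟩ := z
  exact top_mem hℓ hT hz h1 h2 hL hac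

theorem reg_insert {ℓ : ℕ} (hℓ : 2 < ℓ) {rl nu : YPartition} (hr : TopJustified ℓ rl)
    (hn : TopJustified ℓ nu) (k : ℕ)
    (hc : ∀ m, ladderCount ℓ nu m = ladderCount ℓ rl m + if m = k then 1 else 0) :
    ∃ p, ladderIdx ℓ p = k ∧ p ∉ rl.cells ∧ nu.cells = insert p rl.cells := by
  have hfin : ∀ (μ : YPartition) (m : ℕ), (μ.cells ∩ {p | ladderIdx ℓ p = m}).Finite :=
    fun μ m => (cells_finite μ).subset Set.inter_subset_left
  have hsub : ∀ m, rl.cells ∩ {p | ladderIdx ℓ p = m} ⊆ nu.cells ∩ {p | ladderIdx ℓ p = m} := by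
    intro m
    by_contra hns
    obtain ⟨x, ⟨hx, hxm⟩, hxn⟩ := Set.not_subset.1 hns
    have hxm : ladderIdx ℓ x = m := hxm
    have hxn : x ∉ nu.cells := fun h => hxn ⟨h, hxm⟩
    have hss : nu.cells ∩ {p | ladderIdx ℓ p = m} ⊆ rl.cells ∩ {p | ladderIdx ℓ p = m} := by
      rintro y ⟨hy, hym⟩
      have hym : ladderIdx ℓ y = m := hym
      refine ⟨?_, hym⟩
      rcases le_total y.1 x.1 with h | h
      · exact top_mem' hℓ hr hx hy.1 hy.2.1 (hym.trans hxm.symm) h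
      · exact absurd (top_mem' hℓ hn hy hx.1 hx.2.1 (hxm.trans hym.symm) h) hxn
    have := Set.eq_of_subset_of_ncard_le hss (by
      have := hc m
      unfold ladderCount at this
      omega) (hfin rl m)
    exact hns this.ge
  have hk := hc k
  rw [if_pos rfl] at hk
  unfold ladderCount at hk
  have h1 := Set.ncard_sdiff_add_ncard_of_subset (hsub k) (hfin nu k)
  have h1' : ((nu.cells ∩ {p | ladderIdx ℓ p = k}) \
      (rl.cells ∩ {p | ladderIdx ℓ p = k})).ncard = 1 := by omega
  obtain ⟨p, hp⟩ := Set.ncard_eq_one.1 h1'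
  have hpm : p ∈ (nu.cells ∩ {p | ladderIdx ℓ p = k}) \ (rl.cells ∩ {p | ladderIdx ℓ p = k}) := by
    rw [hp]; exact Set.mem_singleton p
  have hpk : ladderIdx ℓ p = k := hpm.1.2
  refine ⟨p, hpk, fun h => hpm.2 ⟨h, hpk⟩, ?_⟩
  apply Set.Subset.antisymm
  · intro y hy
    by_cases hyr : y ∈ rl.cells
    · exact Or.inr hyr
    left
    by_cases hyk : ladderIdx ℓ y = k
    · have : y ∈ (nu.cells ∩ {p | ladderIdx ℓ p = k}) \ (rl.cells ∩ {p | ladderIdx ℓ p = k}) :=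
        ⟨⟨hy, hyk⟩, fun h => hyr h.1⟩
      rw [hp] at this
      exact this
    · exfalso
      have h2 := hc (ladderIdx ℓ y)
      rw [if_neg hyk] at h2
      unfold ladderCount at h2
      have h3 := Set.eq_of_subset_of_ncard_le (hsub (ladderIdx ℓ y)) (by omega) (hfin nu _)
      have h4 : y ∈ nu.cells ∩ {p | ladderIdx ℓ p = ladderIdx ℓ y} := ⟨hy, rfl⟩
      rw [← h3] at h4
      exact hyr h4.1
  · intro y hy
    rcases hy with rfl | hy
    · exact hpm.1.1
    · exact (hsub (ladderIdx ℓ y) ⟨hy, rfl⟩).1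

theorem count_insert {ℓ : ℕ} {lam mu : YPartition} {p : ℕ × ℕ} (hp : p ∉ lam.cells)
    (h : mu.cells = insert p lam.cells) (m : ℕ) :
    ladderCount ℓ mu m = ladderCount ℓ lam m + if m = ladderIdx ℓ p then 1 else 0 := by
  unfold ladderCount
  rw [h]
  split_ifs with hm
  · rw [Set.insert_inter_of_mem (show p ∈ {p | ladderIdx ℓ p = m} from hm.symm)]
    exact Set.ncard_insert_of_notMem (fun hh => hp hh.1)
      ((cells_finite lam).subset Set.inter_subset_left)
  · rw [Set.insert_inter_of_notMem
      (show p ∉ {p | ladderIdx ℓ p = m} from fun hh => hm (Eq.symm hh)), add_zero]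

theorem exists_hatF {ℓ i : ℕ} {μ : YPartition} :
    (∃ ν, HatF ℓ i μ ν) ↔ ∃ q, LadderConormal ℓ i μ q := by
  constructor
  · rintro ⟨ν, p, hp, _⟩
    exact ⟨p, hp.1⟩
  · rintro hq
    obtain ⟨p, hp, hmax⟩ := Set.exists_max_image {q | LadderConormal ℓ i μ q} (lkey ℓ)
      ((addRes_finite ℓ i μ).subset fun _ h => h.1) hq
    have hp : LadderConormal ℓ i μ p := hp
    obtain ⟨ν, hν⟩ := exists_add μ p hp.1.1
    exact ⟨ν, p, ⟨hp, fun q hq => (ladderLE_iff ℓ q p).2 (hmax q hq)⟩, hν⟩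

theorem exists_tildeF {ℓ i : ℕ} {μ : YPartition} :
    (∃ ν, TildeF ℓ i μ ν) ↔ ∃ q, ClassConormal ℓ i μ q := by
  constructor
  · rintro ⟨ν, p, hp, _⟩
    exact ⟨p, hp.1⟩
  · rintro hq
    obtain ⟨p, hp, hmax⟩ := Set.exists_max_image {q | ClassConormal ℓ i μ q} rkey
      ((addRes_finite ℓ i μ).subset fun _ h => h.1) hq
    have hp : ClassConormal ℓ i μ p := hp
    obtain ⟨ν, hν⟩ := exists_add μ p hp.1.1
    exact ⟨ν, p, ⟨hp, fun q hq => (rowLE_iff q p).2 (hmax q hq)⟩, hν⟩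

theorem exists_hatE {ℓ i : ℕ} {μ : YPartition} :
    (∃ ν, HatE ℓ i μ ν) ↔ ∃ q, LadderNormal ℓ i μ q := by
  constructor
  · rintro ⟨ν, p, hp, _⟩
    exact ⟨p, hp.1⟩
  · rintro hq
    obtain ⟨p, hp, hmin⟩ := Set.exists_min_image {q | LadderNormal ℓ i μ q} (lkey ℓ)
      ((remRes_finite ℓ i μ).subset fun _ h => h.1) hq
    have hp : LadderNormal ℓ i μ p := hp
    obtain ⟨ν, hν⟩ := exists_rem μ p hp.1.1
    exact ⟨ν, p, ⟨hp, fun q hq => (ladderLE_iff ℓ p q).2 (hmin q hq)⟩, hν⟩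

theorem exists_tildeE {ℓ i : ℕ} {μ : YPartition} :
    (∃ ν, TildeE ℓ i μ ν) ↔ ∃ q, ClassNormal ℓ i μ q := by
  constructor
  · rintro ⟨ν, p, hp, _⟩
    exact ⟨p, hp.1⟩
  · rintro hq
    obtain ⟨p, hp, hmin⟩ := Set.exists_min_image {q | ClassNormal ℓ i μ q} rkey
      ((remRes_finite ℓ i μ).subset fun _ h => h.1) hq
    have hp : ClassNormal ℓ i μ p := hp
    obtain ⟨ν, hν⟩ := exists_rem μ p hp.1.1
    exact ⟨ν, p, ⟨hp, fun q hq => (rowLE_iff p q).2 (hmin q hq)⟩, hν⟩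

theorem main_F {ℓ i : ℕ} (hℓ : 2 < ℓ) {lam rl mu nu : YPartition} (hH : HookFree ℓ lam)
    (hreg : IsRegularization ℓ lam rl) (hF : HatF ℓ i lam mu) (hnu : IsRegularization ℓ mu nu) :
    TildeF ℓ i rl nu := by
  obtain ⟨p, ⟨hp, hmax⟩, hmu⟩ := hF
  obtain ⟨hS, hT⟩ := hreg
  obtain ⟨hS', hT'⟩ := hnu
  have hpn := addable_not_mem hp.1.1
  obtain ⟨p', hk, hp'n, hins⟩ := reg_insert hℓ hT hT' (ladderIdx ℓ p) (fun m => by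
    rw [← hS' m, ← hS m]; exact count_insert hpn hmu m)
  have hp'A := addable_of_insert rl nu p' hins hp'n
  have hp'pos := addable_pos hp'A
  have hp'nu : p' ∈ nu.cells := by rw [hins]; exact Set.mem_insert _ _
  have hp'i : p' ∈ AddableRes ℓ i rl :=
    ⟨hp'A, (res_congr ℓ hℓ p' p hp'pos.2 (addable_pos hp.1.1).2 hk).trans hp.1.2⟩
  -- addable boxes on the ladder are below the new box
  have hbelow : ∀ q, Addable rl q → ladderIdx ℓ q = ladderIdx ℓ p → p'.1 ≤ q.1 := by
    intro q hq hqk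
    by_contra hlt
    have h1 : q ∈ nu.cells := top_mem' hℓ hT' hp'nu (addable_pos hq).1 (addable_pos hq).2
      (hqk.trans hk.symm) (by omega)
    rw [hins] at h1
    rcases h1 with h1 | h1
    · rw [h1] at hlt; exact hlt le_rfl
    · exact addable_not_mem hq h1
  obtain ⟨n, hn, hnk⟩ := (reg_charF (i := i) hℓ hT (ladderIdx ℓ p)).2
    ((condF_inv hℓ i _ hS).1 ((hook_charF hℓ hH _).1 ⟨p, hp, rfl⟩))
  refine ⟨p', ⟨?_, ?_⟩, hins⟩
  · refine conormal_ext RowLE rkey rowLE_iff _ _ (remRes_finite ℓ i rl) (addRes_finite ℓ i rl)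
      n p' hn hp'i (hbelow n hn.1.1 hnk) ?_
    intro r hr h1 h2
    have h1 : r.1 ≤ n.1 := h1
    have h2 : p'.1 ≤ r.1 := h2
    rcases lt_trichotomy (ladderIdx ℓ r) (ladderIdx ℓ p) with h | h | h
    · have := reg_rows hℓ hT (Or.inr hr.1) (Or.inl hn.1.1) (hr.2.trans hn.1.2.symm)
        (by rw [hnk]; exact h)
      omega
    · exact hp'n (top_mem' hℓ hT (removable_mem hr.1) hp'pos.1 hp'pos.2 (hk.trans h.symm) h2)
    · have := reg_rows hℓ hT (Or.inl hp'A) (Or.inr hr.1) (hp'i.2.trans hr.2.symm)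
        (by rw [hk]; exact h)
      omega
  · intro q hq
    obtain ⟨q0, hq0, hq0k⟩ := (hook_charF (i := i) hℓ hH (ladderIdx ℓ q)).2
      ((condF_inv hℓ i _ hS).2 ((reg_charF hℓ hT _).1 ⟨q, hq, rfl⟩))
    have hle : ladderIdx ℓ q ≤ ladderIdx ℓ p := by
      rw [← hq0k]
      rcases hmax q0 hq0 with h | h
      · exact h.le
      · exact h.1.le
    change p'.1 ≤ q.1
    rcases hle.lt_or_eq with h | h
    · exact (reg_rows hℓ hT (Or.inl hq.1.1) (Or.inl hp'A) (hq.1.2.trans hp'i.2.symm)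
        (by rw [hk]; exact h)).le
    · exact hbelow q hq.1.1 h

theorem main_E {ℓ i : ℕ} (hℓ : 2 < ℓ) {lam rl mu nu : YPartition} (hH : HookFree ℓ lam)
    (hreg : IsRegularization ℓ lam rl) (hE : HatE ℓ i lam mu) (hnu : IsRegularization ℓ mu nu) :
    TildeE ℓ i rl nu := by
  obtain ⟨p, ⟨hp, hmin⟩, hmu⟩ := hE
  obtain ⟨hS, hT⟩ := hreg
  obtain ⟨hS', hT'⟩ := hnu
  have hpm := removable_mem hp.1.1
  have hpn : p ∉ mu.cells := by rw [hmu]; exact fun h => h.2 rfl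
  have hlam : lam.cells = insert p mu.cells := by
    rw [hmu, Set.insert_sdiff_singleton, Set.insert_eq_of_mem hpm]
  obtain ⟨p', hk, hp'n, hins⟩ := reg_insert hℓ hT' hT (ladderIdx ℓ p) (fun m => by
    rw [← hS' m, ← hS m]; exact count_insert hpn hlam m)
  have hp'R := removable_of_insert rl nu p' hins hp'n
  have hp'm := removable_mem hp'R
  have hp'i : p' ∈ RemovableRes ℓ i rl :=
    ⟨hp'R, (res_congr ℓ hℓ p' p hp'm.2.1 hpm.2.1 hk).trans hp.1.2⟩
  -- boxes on the ladder are above the removed box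
  have habove : ∀ q, q ∈ rl.cells → ladderIdx ℓ q = ladderIdx ℓ p → q.1 ≤ p'.1 := by
    intro q hq hqk
    by_contra hlt
    rw [hins] at hq
    rcases hq with h1 | h1
    · rw [h1] at hlt; exact hlt le_rfl
    · exact hp'n (top_mem' hℓ hT' h1 hp'm.1 hp'm.2.1 (hk.trans hqk.symm) (by omega))
  obtain ⟨n, hn, hnk⟩ := (reg_charE (i := i) hℓ hT (ladderIdx ℓ p + ℓ)).2
    ((condE_inv hℓ i _ hS).1 ((hook_charE hℓ hH _).1 ⟨p, hp, rfl⟩))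
  have hnk : ladderIdx ℓ n = ladderIdx ℓ p := by omega
  refine ⟨p', ⟨?_, ?_⟩, ?_⟩
  · refine normal_ext RowLE rkey rowLE_iff _ _ (remRes_finite ℓ i rl) (addRes_finite ℓ i rl)
      n p' hn hp'i (habove n (removable_mem hn.1.1) hnk) ?_
    intro r hr h1 h2
    have h1 : r.1 ≤ p'.1 := h1
    have h2 : n.1 ≤ r.1 := h2
    rcases lt_trichotomy (ladderIdx ℓ r) (ladderIdx ℓ p) with h | h | h
    · have := reg_rows hℓ hT (Or.inl hr.1) (Or.inr hp'R) (hr.2.trans hp'i.2.symm)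
        (by rw [hk]; exact h)
      omega
    · exact addable_not_mem hr.1 (top_mem' hℓ hT hp'm (addable_pos hr.1).1 (addable_pos hr.1).2
        (h.trans hk.symm) h1)
    · have := reg_rows hℓ hT (Or.inr hn.1.1) (Or.inl hr.1) (hn.1.2.trans hr.2.symm)
        (by rw [hnk]; exact h)
      omega
  · intro q hq
    obtain ⟨q0, hq0, hq0k⟩ := (hook_charE (i := i) hℓ hH (ladderIdx ℓ q + ℓ)).2
      ((condE_inv hℓ i _ hS).2 ((reg_charE hℓ hT _).1 ⟨q, hq, rfl⟩))
    have hle : ladderIdx ℓ p ≤ ladderIdx ℓ q := by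
      rcases hmin q0 hq0 with h | h
      · omega
      · have := h.1; omega
    change q.1 ≤ p'.1
    rcases hle.lt_or_eq with h | h
    · exact (reg_rows hℓ hT (Or.inr hp'R) (Or.inr hq.1.1) (hp'i.2.trans hq.1.2.symm)
        (by rw [hk]; exact h)).le
    · exact habove q (removable_mem hq.1.1) h.symm
  · rw [hins]
    ext y
    constructor
    · intro hy
      exact ⟨Or.inr hy, fun h => hp'n (by rw [← show y = p' from h]; exact hy)⟩
    · rintro ⟨h | h, h2⟩
      · exact absurd h h2
      · exact h

end Final

/-- regularization commutes with the crystal operators: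
`R(f̂_i λ) = f̃_i(Rλ)` and `R(ê_i λ) = ẽ_i(Rλ)` (with `R 0 = 0`), for every node `λ` of
`B(Λ₀)^L`. -/
theorem statement18 (ℓ : ℕ) (hℓ : 2 < ℓ) (i : ℕ) (hi : i < ℓ) (lam rl : YPartition)
    (hnode : LadderNode ℓ lam) (hreg : IsRegularization ℓ lam rl) :
    ((∃ mu : YPartition, HatF ℓ i lam mu) ↔ (∃ nu : YPartition, TildeF ℓ i rl nu)) ∧
    (∀ mu nu : YPartition, HatF ℓ i lam mu → IsRegularization ℓ mu nu →
      TildeF ℓ i rl nu) ∧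
    ((∃ mu : YPartition, HatE ℓ i lam mu) ↔ (∃ nu : YPartition, TildeE ℓ i rl nu)) ∧
    (∀ mu nu : YPartition, HatE ℓ i lam mu → IsRegularization ℓ mu nu →
      TildeE ℓ i rl nu) := by

  have hH := HookFree.node hℓ hnode
  refine ⟨?_, fun mu nu h1 h2 => main_F hℓ hH hreg h1 h2, ?_,
    fun mu nu h1 h2 => main_E hℓ hH hreg h1 h2⟩
  · rw [exists_hatF, exists_tildeF]
    constructor
    · rintro ⟨q, hq⟩
      obtain ⟨n, hn, _⟩ := (reg_charF (i := i) hℓ hreg.2 (ladderIdx ℓ q)).2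
        ((condF_inv hℓ i _ hreg.1).1 ((hook_charF hℓ hH _).1 ⟨q, hq, rfl⟩))
      exact ⟨n, hn⟩
    · rintro ⟨q, hq⟩
      obtain ⟨n, hn, _⟩ := (hook_charF (i := i) hℓ hH (ladderIdx ℓ q)).2
        ((condF_inv hℓ i _ hreg.1).2 ((reg_charF hℓ hreg.2 _).1 ⟨q, hq, rfl⟩))
      exact ⟨n, hn⟩
  · rw [exists_hatE, exists_tildeE]
    constructor
    · rintro ⟨q, hq⟩
      obtain ⟨n, hn, _⟩ := (reg_charE (i := i) hℓ hreg.2 (ladderIdx ℓ q + ℓ)).2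
        ((condE_inv hℓ i _ hreg.1).1 ((hook_charE hℓ hH _).1 ⟨q, hq, rfl⟩))
      exact ⟨n, hn⟩
    · rintro ⟨q, hq⟩
      obtain ⟨n, hn, _⟩ := (hook_charE (i := i) hℓ hH (ladderIdx ℓ q + ℓ)).2
        ((condE_inv hℓ i _ hreg.1).2 ((reg_charE hℓ hreg.2 _).1 ⟨q, hq, rfl⟩))
      exact ⟨n, hn⟩
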